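/- arXiv:1504.08138 — 5 statements merged into one kernel-verified Lean document; each statement's English description precedes it below -/
import Mathlib

section
/- (Weight 12 relation among bi-brackets from Rankin–Cohen brackets.) In ℚ[[q]] the following identity of bi-brackets holds: 7·[5;1]·[6] − 7·[4]·[7;1] + 4·[4]·[6;2] − 2·[5;1]·[5;1] = (7/1440)·[7;1] − (1/360)·[6;2] + (1/8640)·[5;1], where [s] denotes the bracket (the bi-bracket [s; 0]). -/
open scoped Nat

/-- The bi-bracket `[s₁,…,sₗ; r₁,…,rₗ]`: the formal power series in `ℚ[[q]]` whose
coefficient of `qⁿ` is the sum of `∏ⱼ (uⱼ^{rⱼ}/rⱼ!)·(vⱼ^{sⱼ−1}/(sⱼ−1)!)` over all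
tuples `u₁ > … > uₗ > 0`, `v₁,…,vₗ > 0` with `u₁v₁ + … + uₗvₗ = n`. -/
noncomputable def biBracket (l : ℕ) (s r : Fin l → ℕ) : PowerSeries ℚ :=
  PowerSeries.mk fun n =>
    ∑ᶠ uv ∈ {uv : (Fin l → ℕ) × (Fin l → ℕ) |
        StrictAnti uv.1 ∧ (∀ j, 0 < uv.1 j) ∧ (∀ j, 0 < uv.2 j) ∧
        (∑ j, uv.1 j * uv.2 j) = n},
      ∏ j, ((uv.1 j : ℚ) ^ r j / (r j)!) * ((uv.2 j : ℚ) ^ (s j - 1) / ((s j - 1)!))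


namespace BiBracket

open UpperHalfPlane hiding I
open ModularForm EisensteinSeries Derivative Complex
open Function.Periodic (qParam)
open scoped Real Manifold MatrixGroups ArithmeticFunction.sigma PowerSeries

/-- The coefficients of a length-one bi-bracket are twisted divisor sums. -/
lemma coeff_biBracket_one (k r n : ℕ) :
    (biBracket 1 ![r + k + 1] ![r]).coeff n =
      (n : ℚ) ^ r * (σ k n : ℚ) / (r ! * (r + k)!) := by
  rw [biBracket, PowerSeries.coeff_mk]
  have key : ∀ p ∈ n.divisorsAntidiagonal,
      ((p.1 : ℚ) ^ r / r !) * ((p.2 : ℚ) ^ (r + k) / (r + k)!) =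
        (n : ℚ) ^ r * (p.2 : ℚ) ^ k / (r ! * (r + k)!) := by
    intro p hp
    rw [← (Nat.mem_divisorsAntidiagonal.mp hp).1]
    push_cast
    field_simp
    ring
  let e : ℕ × ℕ → (Fin 1 → ℕ) × (Fin 1 → ℕ) := fun p ↦ (fun _ ↦ p.1, fun _ ↦ p.2)
  have he : Function.Injective e := fun p p' h ↦ by
    simp only [e, Prod.mk.injEq, funext_iff] at h
    exact Prod.ext (h.1 0) (h.2 0)
  have hset : {uv : (Fin 1 → ℕ) × (Fin 1 → ℕ) |
        StrictAnti uv.1 ∧ (∀ j, 0 < uv.1 j) ∧ (∀ j, 0 < uv.2 j) ∧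
        (∑ j, uv.1 j * uv.2 j) = n} = e '' (n.divisorsAntidiagonal : Set (ℕ × ℕ)) := by
    ext ⟨u, v⟩
    simp only [Set.mem_ofPred_eq, Set.mem_image, Finset.mem_coe, Nat.mem_divisorsAntidiagonal,
      Fin.forall_fin_one, Fin.sum_univ_one]
    constructor
    · rintro ⟨-, hu, hv, h⟩
      refine ⟨(u 0, v 0), ⟨h, ?_⟩, ?_⟩
      · rw [← h]; positivity
      · simp only [e, Prod.mk.injEq, funext_iff, Fin.forall_fin_one, and_self]
    · rintro ⟨⟨a, b⟩, ⟨h, h0⟩, h'⟩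
      simp only [e, Prod.mk.injEq] at h'
      obtain ⟨rfl, rfl⟩ := h'
      have hab : a * b ≠ 0 := by rwa [h]
      exact ⟨Subsingleton.strictAnti _, Nat.pos_of_ne_zero (left_ne_zero_of_mul hab),
        Nat.pos_of_ne_zero (right_ne_zero_of_mul hab), h⟩
  rw [hset, finsum_mem_image he.injOn, finsum_mem_coe_finset]
  simp only [e, Fin.prod_univ_one, Matrix.cons_val_fin_one, Nat.add_sub_cancel]
  rw [Finset.sum_congr rfl key, ← Finset.sum_div, ← Finset.mul_sum,
    ArithmeticFunction.sigma_apply]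
  push_cast
  rw [Nat.sum_divisorsAntidiagonal' (fun _ b ↦ (b : ℚ) ^ k)]

/-- The derivation `q d/dq` on formal power series. -/
noncomputable def theta : Derivation ℂ ℂ⟦X⟧ ℂ⟦X⟧ :=
  (PowerSeries.X : ℂ⟦X⟧) • PowerSeries.derivative ℂ

lemma coeff_theta (p : ℂ⟦X⟧) (n : ℕ) : (theta p).coeff n = n * p.coeff n := by
  rcases n with _ | n
  · simp [theta]
  · simp [theta, PowerSeries.coeff_succ_X_mul, PowerSeries.coeff_derivative, mul_comm]

lemma constantCoeff_theta (p : ℂ⟦X⟧) : PowerSeries.constantCoeff (theta p) = 0 := by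
  simp [theta]

/-- `f` is the sum of the power series `p` evaluated at `q = exp (2πiτ)`. -/
def HasQExpansion (f : ℍ → ℂ) (p : ℂ⟦X⟧) : Prop :=
  ∀ τ : ℍ, HasSum (fun m : ℕ ↦ p.coeff m * qParam 1 τ ^ m) (f τ)

namespace HasQExpansion

variable {f g : ℍ → ℂ} {p r : ℂ⟦X⟧}

lemma add (hf : HasQExpansion f p) (hg : HasQExpansion g r) : HasQExpansion (f + g) (p + r) :=
  fun τ ↦ by simpa [add_mul] using (hf τ).add (hg τ)

lemma sub (hf : HasQExpansion f p) (hg : HasQExpansion g r) : HasQExpansion (f - g) (p - r) :=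
  fun τ ↦ by simpa [sub_mul] using (hf τ).sub (hg τ)

lemma smul (c : ℂ) (hf : HasQExpansion f p) : HasQExpansion (c • f) (c • p) :=
  fun τ ↦ by simpa [mul_assoc] using (hf τ).mul_left c

lemma mul (hf : HasQExpansion f p) (hg : HasQExpansion g r) : HasQExpansion (f * g) (p * r) := by
  intro τ
  have hp := (hf τ).summable.norm
  have hr := (hg τ).summable.norm
  have hs := (summable_norm_sum_mul_antidiagonal_of_summable_norm hp hr).of_norm.hasSum
  rw [← tsum_mul_tsum_eq_tsum_sum_antidiagonal_of_summable_norm hp hr, (hf τ).tsum_eq,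
    (hg τ).tsum_eq] at hs
  convert! hs using 2 with m
  rw [PowerSeries.coeff_mul, Finset.sum_mul]
  refine Finset.sum_congr rfl fun kl hkl ↦ ?_
  rw [← Finset.HasAntidiagonal.mem_antidiagonal.mp hkl]
  ring

lemma isBoundedAtImInfty (hf : HasQExpansion f p) : IsBoundedAtImInfty f :=
  isBoundedAtImInfty_of_hasSum_qExpansion one_pos hf

lemma normalizedDeriv (hf : HasQExpansion f p) : HasQExpansion (D f) (theta p) := by
  intro τ
  let U : Set ℂ := {w | τ.im / 2 < w.im}
  have hU : IsOpen U := isOpen_lt continuous_const continuous_im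
  have hτ : (τ : ℂ) ∈ U := half_lt_self τ.im_pos
  let τ' : ℍ := ⟨(τ.im / 2 : ℝ) * I, by simpa using half_pos τ.im_pos⟩
  have hsum : HasSum _ _ := hasSum_deriv_of_summable_norm
    (F := fun (m : ℕ) (w : ℂ) ↦ p.coeff m * qParam 1 w ^ m) (hf τ').summable.norm
    (fun m ↦ by unfold qParam; fun_prop) hU (fun m w hw ↦ ?_) hτ
  · have hd : deriv (f ∘ ofComplex) τ =
        deriv (fun w : ℂ ↦ ∑' m : ℕ, p.coeff m * qParam 1 w ^ m) τ := by
      refine Filter.EventuallyEq.deriv_eq ?_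
      filter_upwards [isOpen_upperHalfPlaneSet.mem_nhds τ.im_pos] with w hw
      simpa [ofComplex_apply_of_im_pos hw] using (hf ⟨w, hw⟩).tsum_eq.symm
    rw [normalizedDerivOfComplex, hd]
    convert! hsum.mul_left (2 * π * I : ℂ)⁻¹ using 2 with m
    have hexp (w : ℂ) : p.coeff m * qParam 1 w ^ m = p.coeff m * exp (m * (2 * π * I) * w) := by
      rw [qParam, ← exp_nat_mul]
      simp [mul_assoc]
    have hderiv : HasDerivAt (fun w : ℂ ↦ p.coeff m * exp (m * (2 * π * I) * w))
        (p.coeff m * (exp (m * (2 * π * I) * τ) * (m * (2 * π * I)))) τ := by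
      simpa using (((hasDerivAt_id (τ : ℂ)).const_mul (m * (2 * π * I) : ℂ)).cexp).const_mul
        (p.coeff m)
    rw [coeff_theta, mul_assoc, hexp]
    simp_rw [hexp]
    rw [hderiv.deriv]
    field_simp
  · simp only [norm_mul, norm_pow, Function.Periodic.norm_qParam]
    gcongr ‖_‖ * Real.exp ?_ ^ m
    have hw' : τ.im / 2 < w.im := hw
    have hτ' : τ'.im = τ.im / 2 := by simp [τ', ← coe_im]
    simp only [coe_im, hτ']
    nlinarith [Real.pi_pos]

end HasQExpansion

/-- A level-one modular form of weight less than `12` vanishes once its constant term does. -/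
lemma eq_zero_of_slash_invariant {f : ℍ → ℂ} {p : ℂ⟦X⟧} (k : ℕ) (hk : k < 12)
    (hf : HasQExpansion f p) (hdiff : MDiff f) (hslash : ∀ γ : SL(2, ℤ), f ∣[(k : ℤ)] γ = f)
    (hp : p.coeff 0 = 0) : p = 0 := by
  let F : ModularForm 𝒮ℒ (k : ℤ) :=
    { toFun := f
      slash_action_eq' := fun _ ⟨γ, hγ⟩ ↦ hγ ▸ hslash γ
      holo' := hdiff
      bdd_at_cusps' {c} hc := by
        rw [Subgroup.IsArithmetic.isCusp_iff_isCusp_SL2Z] at hc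
        rw [OnePoint.isBoundedAt_iff_forall_SL2Z hc]
        intro γ _
        rw [hslash γ]
        exact hf.isBoundedAtImInfty }
  have hq : ∀ m, p.coeff m = (qExpansion 1 F).coeff m :=
    ModularFormClass.qExpansion_coeff_unique one_pos one_mem_strictPeriods_SL hf
  have hF : F = 0 := by
    refine sturm_bound_levelOne_nat ?_
    rw [Nat.div_eq_of_lt hk, Nat.cast_zero, pos_iff_ne_zero,
      PowerSeries.order_ne_zero_iff_constCoeff_eq_zero,
      ← PowerSeries.coeff_zero_eq_constantCoeff_apply, ← hq, hp]
  ext m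
  rw [hq, hF]
  simp [qExpansion_zero]

/-- The generating series of `σ k`. -/
noncomputable def sigmaSeries (k : ℕ) : ℂ⟦X⟧ := PowerSeries.mk fun n ↦ (σ k n : ℂ)

lemma hasQExpansion_E2 : HasQExpansion E2 (1 - (24 : ℂ) • sigmaSeries 1) := by
  intro τ
  convert hasSum_qExpansion_E2 (z := τ) using 2 with m
  rcases eq_or_ne m 0 with rfl | hm
  · simp [sigmaSeries]
  · simp [sigmaSeries, hm, PowerSeries.coeff_one, qParam]

lemma hasQExpansion_E {k : ℕ} (hk : 3 ≤ k) (hk2 : Even k) :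
    HasQExpansion (E hk) (1 - (2 * k / bernoulli k : ℂ) • sigmaSeries (k - 1)) := by
  intro τ
  convert! ModularForm.hasSum_qExpansion (E hk) one_pos one_mem_strictPeriods_SL τ using 2 with m
  rw [E_qExpansion_coeff hk hk2]
  rcases eq_or_ne m 0 with rfl | hm
  · simp [sigmaSeries]
  · simp [sigmaSeries, hm, PowerSeries.coeff_one]

lemma hasQExpansion_E₄ : HasQExpansion E₄ (1 + (240 : ℂ) • sigmaSeries 3) := by
  convert hasQExpansion_E (k := 4) (by norm_num) ⟨2, rfl⟩ using 1
  norm_num [show bernoulli 4 = -1 / 30 by decide +kernel]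

lemma hasQExpansion_E₆ : HasQExpansion E₆ (1 - (504 : ℂ) • sigmaSeries 5) := by
  convert hasQExpansion_E (k := 6) (by norm_num) ⟨3, rfl⟩ using 1
  norm_num [show bernoulli 6 = 1 / 42 by decide +kernel]

lemma E_slash {k : ℕ} (hk : 3 ≤ k) (γ : SL(2, ℤ)) : (E hk : ℍ → ℂ) ∣[(k : ℤ)] γ = E hk :=
  SlashInvariantFormClass.slash_action_eq (E hk) _ ⟨γ, rfl⟩

lemma hasDerivAt_D2 (γ : SL(2, ℤ)) (z : ℍ) :
    HasDerivAt (D2 γ ∘ ofComplex) (-(2 * π * I) * (γ 1 0 / denom γ z) ^ 2) z := by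
  have hd := denom_ne_zero γ z
  have hlin : HasDerivAt (fun w : ℂ ↦ (γ 1 0 : ℂ) * w + γ 1 1) (γ 1 0) z := by
    simpa using ((hasDerivAt_id (z : ℂ)).const_mul (γ 1 0 : ℂ)).add_const (γ 1 1 : ℂ)
  have hden : (γ 1 0 : ℂ) * z + γ 1 1 = denom γ z := (ModularGroup.denom_apply γ z).symm
  have hquot := (hasDerivAt_const (z : ℂ) (2 * π * I * γ 1 0 : ℂ)).div hlin (by rwa [hden])
  rw [hden] at hquot
  refine (hquot.congr_of_eventuallyEq ?_).congr_deriv ?_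
  · filter_upwards [isOpen_upperHalfPlaneSet.mem_nhds z.im_pos] with w hw
    simpa [D2, ofComplex_apply_of_im_pos hw] using
      congrArg (2 * π * I * γ 1 0 / ·) (ModularGroup.denom_apply γ ⟨w, hw⟩)
  · field_simp
    ring

lemma normalizedDeriv_D2 (γ : SL(2, ℤ)) :
    D (D2 γ) = (4 * π ^ 2 : ℂ)⁻¹ • (D2 γ * D2 γ) := by
  ext z
  have hπ : (π : ℂ) ≠ 0 := ofReal_ne_zero.mpr Real.pi_ne_zero
  have hd := denom_ne_zero γ z
  rw [normalizedDerivOfComplex, (hasDerivAt_D2 γ z).deriv]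
  simp only [D2, Pi.smul_apply, Pi.mul_apply, smul_eq_mul]
  field_simp
  linear_combination -(4 * (γ 1 0 : ℂ) ^ 2) * I_sq

lemma mdifferentiable_D2 (γ : SL(2, ℤ)) : MDiff (D2 γ) := fun z ↦
  mdifferentiableAt_iff.mpr (hasDerivAt_D2 γ z).differentiableAt

/-- The Ramanujan combination `D E₂ - E₂² / 12` is invariant of weight `4`. -/
lemma ramanujan_E2_slash (γ : SL(2, ℤ)) :
    (D E2 - (12⁻¹ : ℂ) • (E2 * E2)) ∣[(4 : ℤ)] γ = D E2 - (12⁻¹ : ℂ) • (E2 * E2) := by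
  have hπ : (π : ℂ) ≠ 0 := ofReal_ne_zero.mpr Real.pi_ne_zero
  have hserre : D E2 - (12⁻¹ : ℂ) • (E2 * E2) =
      serreDerivative 2 E2 + (12⁻¹ : ℂ) • (E2 * E2) := by
    ext z
    simp
    ring
  have hmul := mul_slash_SL2 2 2 γ E2 E2
  have hequi := serreDerivative_slash_equivariant (k := 2) (γ := γ) E2_mdifferentiable
  norm_num only at hmul hequi
  rw [hserre, SlashAction.add_slash, SL_smul_slash, hmul, hequi, E2_slash_action,
    serreDerivative_sub _ _ _ E2_mdifferentiable ((mdifferentiable_D2 γ).const_smul _),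
    serreDerivative_smul _ _ _ (mdifferentiable_D2 γ)]
  ext z
  simp [normalizedDeriv_D2, riemannZeta_two]
  field_simp
  ring

lemma theta_E2 : theta (1 - (24 : ℂ) • sigmaSeries 1) =
    (12⁻¹ : ℂ) • ((1 - (24 : ℂ) • sigmaSeries 1) * (1 - (24 : ℂ) • sigmaSeries 1)) -
      (12⁻¹ : ℂ) • (1 + (240 : ℂ) • sigmaSeries 3) := by
  have hq := (hasQExpansion_E2.normalizedDeriv.sub
    ((hasQExpansion_E2.mul hasQExpansion_E2).smul 12⁻¹)).add (hasQExpansion_E₄.smul 12⁻¹)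
  have h0 := eq_zero_of_slash_invariant 4 (by norm_num) hq
    (((normalizedDerivOfComplex_mdifferentiable E2_mdifferentiable).sub
      ((E2_mdifferentiable.mul E2_mdifferentiable).const_smul _)).add (E₄.holo'.const_smul _))
    (fun γ ↦ by
      rw [SlashAction.add_slash, SL_smul_slash, E_slash]
      exact congrArg (· + _) (ramanujan_E2_slash γ))
    (by simp [sigmaSeries, constantCoeff_theta])
  linear_combination h0

lemma theta_E₄ : theta (1 + (240 : ℂ) • sigmaSeries 3) =
    (3⁻¹ : ℂ) • ((1 - (24 : ℂ) • sigmaSeries 1) * (1 + (240 : ℂ) • sigmaSeries 3)) -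
      (3⁻¹ : ℂ) • (1 - (504 : ℂ) • sigmaSeries 5) := by
  have hq := (hasQExpansion_E₄.normalizedDeriv.sub
    ((hasQExpansion_E2.mul hasQExpansion_E₄).smul 3⁻¹)).add (hasQExpansion_E₆.smul 3⁻¹)
  have hserre : D E₄ - (3⁻¹ : ℂ) • (E2 * E₄) = serreDerivative (4 : ℤ) E₄ := by
    ext z
    simp
    ring
  have h0 := eq_zero_of_slash_invariant 6 (by norm_num) hq
    (((normalizedDerivOfComplex_mdifferentiable E₄.holo').sub
      ((E2_mdifferentiable.mul E₄.holo').const_smul _)).add (E₆.holo'.const_smul _))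
    (fun γ ↦ by
      rw [SlashAction.add_slash, SL_smul_slash, E_slash, hserre]
      exact congrArg (· + _) (serreDerivative_slash_invariant E₄.holo' (E_slash _ γ)))
    (by simp [sigmaSeries, constantCoeff_theta])
  linear_combination h0

lemma theta_E₆ : theta (1 - (504 : ℂ) • sigmaSeries 5) =
    (2⁻¹ : ℂ) • ((1 - (24 : ℂ) • sigmaSeries 1) * (1 - (504 : ℂ) • sigmaSeries 5)) -
      (2⁻¹ : ℂ) • ((1 + (240 : ℂ) • sigmaSeries 3) * (1 + (240 : ℂ) • sigmaSeries 3)) := by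
  have hq := (hasQExpansion_E₆.normalizedDeriv.sub
    ((hasQExpansion_E2.mul hasQExpansion_E₆).smul 2⁻¹)).add
      ((hasQExpansion_E₄.mul hasQExpansion_E₄).smul 2⁻¹)
  have hserre : D E₆ - (2⁻¹ : ℂ) • (E2 * E₆) = serreDerivative (6 : ℤ) E₆ := by
    ext z
    simp
    ring
  have h0 := eq_zero_of_slash_invariant 8 (by norm_num) hq
    (((normalizedDerivOfComplex_mdifferentiable E₆.holo').sub
      ((E2_mdifferentiable.mul E₆.holo').const_smul _)).add
      ((E₄.holo'.mul E₄.holo').const_smul _))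
    (fun γ ↦ by
      have h4 : (E₄ : ℍ → ℂ) ∣[(4 : ℤ)] γ = E₄ := E_slash _ γ
      have hmul := mul_slash_SL2 4 4 γ E₄ E₄
      rw [h4] at hmul
      rw [SlashAction.add_slash, SL_smul_slash, hserre]
      exact congrArg₂ (· + ·) (serreDerivative_slash_invariant E₆.holo' (E_slash _ γ))
        (congrArg _ hmul))
    (by simp [sigmaSeries, constantCoeff_theta])
  linear_combination h0

lemma theta_sigmaSeries_one : theta (sigmaSeries 1) =
    (-288⁻¹ : ℂ) • ((1 - (24 : ℂ) • sigmaSeries 1) * (1 - (24 : ℂ) • sigmaSeries 1) -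
      (1 + (240 : ℂ) • sigmaSeries 3)) := by
  have h : theta (sigmaSeries 1) = (-24⁻¹ : ℂ) • theta (1 - (24 : ℂ) • sigmaSeries 1) := by
    simp [smul_smul]
  rw [h, theta_E2]
  algebra with ℂ

lemma theta_sigmaSeries_three : theta (sigmaSeries 3) =
    (720⁻¹ : ℂ) • ((1 - (24 : ℂ) • sigmaSeries 1) * (1 + (240 : ℂ) • sigmaSeries 3) -
      (1 - (504 : ℂ) • sigmaSeries 5)) := by
  have h : theta (sigmaSeries 3) = (240⁻¹ : ℂ) • theta (1 + (240 : ℂ) • sigmaSeries 3) := by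
    simp [smul_smul]
  rw [h, theta_E₄]
  algebra with ℂ

lemma theta_sigmaSeries_five : theta (sigmaSeries 5) =
    (-1008⁻¹ : ℂ) • ((1 - (24 : ℂ) • sigmaSeries 1) * (1 - (504 : ℂ) • sigmaSeries 5) -
      (1 + (240 : ℂ) • sigmaSeries 3) * (1 + (240 : ℂ) • sigmaSeries 3)) := by
  have h : theta (sigmaSeries 5) = (-504⁻¹ : ℂ) • theta (1 - (504 : ℂ) • sigmaSeries 5) := by
    simp [smul_smul]
  rw [h, theta_E₆]
  algebra with ℂ

/-- The relation among `σ₃` and `σ₅` series underlying the weight `12` bi-bracket relation. -/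
lemma theta_relation_weight_twelve :
    (7 / 2880 : ℂ) • (theta (sigmaSeries 3) * sigmaSeries 5)
      - (7 / 4320 : ℂ) • (sigmaSeries 3 * theta (sigmaSeries 5))
      + (4 / 1440 : ℂ) • (sigmaSeries 3 * theta (theta (sigmaSeries 3)))
      - (2 / 576 : ℂ) • (theta (sigmaSeries 3) * theta (sigmaSeries 3)) =
    (7 / 1440 / 720 : ℂ) • theta (sigmaSeries 5)
      - (1 / 360 / 240 : ℂ) • theta (theta (sigmaSeries 3))
      + (1 / 8640 / 24 : ℂ) • theta (sigmaSeries 3) := by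
  have h : theta (theta (sigmaSeries 3)) = (720⁻¹ : ℂ) •
      (-(24 : ℂ) • (theta (sigmaSeries 1) * (1 + (240 : ℂ) • sigmaSeries 3)) +
        (240 : ℂ) • ((1 - (24 : ℂ) • sigmaSeries 1) * theta (sigmaSeries 3)) +
        (504 : ℂ) • theta (sigmaSeries 5)) := by
    rw [congrArg theta theta_sigmaSeries_three]
    simp only [Derivation.map_smul, Derivation.map_sub, Derivation.map_add, Derivation.leibniz,
      Derivation.map_one_eq_zero, smul_eq_mul]
    algebra with ℂ
  rw [h, theta_sigmaSeries_one, theta_sigmaSeries_three, theta_sigmaSeries_five]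
  algebra with ℂ

lemma map_smul_rat (c : ℚ) (p : ℚ⟦X⟧) : PowerSeries.map (algebraMap ℚ ℂ) (c • p) =
    (c : ℂ) • PowerSeries.map (algebraMap ℚ ℂ) p := by
  ext n
  simp

lemma map_biBracket_one (k r : ℕ) :
    PowerSeries.map (algebraMap ℚ ℂ) (biBracket 1 ![r + k + 1] ![r]) =
      (r ! * (r + k)! : ℂ)⁻¹ • theta^[r] (sigmaSeries k) := by
  have hiter (n : ℕ) : (theta^[r] (sigmaSeries k)).coeff n = (n : ℂ) ^ r * σ k n := by
    induction r with
    | zero => simp [sigmaSeries]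
    | succ r ih => rw [Function.iterate_succ_apply', coeff_theta, ih]; ring
  ext n
  simp [coeff_biBracket_one, hiter]
  ring

end BiBracket

/-- Weight 12 relation among bi-brackets coming from Rankin–Cohen brackets. -/
theorem biBracket_weight_twelve :
    (7 : ℚ) • (biBracket 1 ![5] ![1] * biBracket 1 ![6] ![0])
      - (7 : ℚ) • (biBracket 1 ![4] ![0] * biBracket 1 ![7] ![1])
      + (4 : ℚ) • (biBracket 1 ![4] ![0] * biBracket 1 ![6] ![2])
      - (2 : ℚ) • (biBracket 1 ![5] ![1] * biBracket 1 ![5] ![1]) =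
    (7 / 1440 : ℚ) • biBracket 1 ![7] ![1] - (1 / 360 : ℚ) • biBracket 1 ![6] ![2]
      + (1 / 8640 : ℚ) • biBracket 1 ![5] ![1] := by
  apply PowerSeries.map_injective (algebraMap ℚ ℂ) (algebraMap ℚ ℂ).injective
  have h40 := BiBracket.map_biBracket_one 3 0
  have h60 := BiBracket.map_biBracket_one 5 0
  have h51 := BiBracket.map_biBracket_one 3 1
  have h71 := BiBracket.map_biBracket_one 5 1
  have h62 := BiBracket.map_biBracket_one 3 2
  norm_num [Nat.factorial] at h40 h60 h51 h71 h62
  simp only [map_add, map_sub, map_mul, BiBracket.map_smul_rat, h40, h60, h51, h71, h62]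
  push_cast
  have h := BiBracket.theta_relation_weight_twelve
  linear_combination (norm := algebra with ℂ) h
end

section
/- For all integers n ≥ 1 and 1 ≤ j ≤ n, the bi-bracket with upper indices (1,1,…,1) (n ones) and lower indices (0,…,0,1,0,…,0) (a single 1 in position j, zeros elsewhere) satisfies [1,…,1; 0^{j−1},1,0^{n−j}] = Σ_{k=1}^{n−j+1} [1^{k−1}, 2, 1^{n−k}], where [1^{k−1}, 2, 1^{n−k}] denotes the length-n bracket whose k-th entry is 2 and all other entries are 1. -/
open scoped Nat

/-- The partial sums `i ↦ ∑_{k + i < n} w k`, listed in decreasing order. -/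
def revPartialSum {n : ℕ} (w : Fin n → ℕ) (i : Fin n) : ℕ :=
  ∑ k : Fin n, if (k : ℕ) + i < n then w k else 0

theorem revPartialSum_succ {n : ℕ} (w : Fin (n + 1) → ℕ) (i : Fin n) :
    revPartialSum w i.succ = revPartialSum (Fin.init w) i := by
  simp only [revPartialSum, Fin.sum_univ_castSucc, Fin.init]
  rw [if_neg (by simp only [Fin.val_last, Fin.val_succ]; omega), add_zero]
  refine Finset.sum_congr rfl fun k _ => ?_
  refine if_congr ?_ rfl rfl
  simp only [Fin.val_castSucc, Fin.val_succ]
  omega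

theorem revPartialSum_zero {n : ℕ} (w : Fin (n + 1) → ℕ) :
    revPartialSum w 0 = ∑ k, Fin.init w k + w (Fin.last n) := by
  simp only [revPartialSum, Fin.val_zero, add_zero, Fin.is_lt, if_true, Fin.sum_univ_castSucc,
    Fin.init]

theorem revPartialSum_injective (n : ℕ) :
    Function.Injective (revPartialSum : (Fin n → ℕ) → Fin n → ℕ) := by
  induction n with
  | zero => exact fun w w' _ => Subsingleton.elim w w'
  | succ n ih =>
    intro w w' h
    have hinit : Fin.init w = Fin.init w' := ih <| funext fun i => by
      rw [← revPartialSum_succ, ← revPartialSum_succ, h]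
    have hlast : w (Fin.last n) = w' (Fin.last n) := by
      have h0 := congrFun h 0
      rw [revPartialSum_zero, revPartialSum_zero, hinit] at h0
      exact Nat.add_left_cancel h0
    rw [← Fin.snoc_init_self w, ← Fin.snoc_init_self w', hinit, hlast]

theorem revPartialSum_pos {n : ℕ} {w : Fin n → ℕ} (hw : ∀ k, 0 < w k) (i : Fin n) :
    0 < revPartialSum w i := by
  refine Finset.sum_pos' (fun _ _ => Nat.zero_le _) ⟨i.rev, Finset.mem_univ _, ?_⟩
  rw [if_pos (by rw [Fin.val_rev]; omega)]
  exact hw _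

theorem strictAnti_revPartialSum {n : ℕ} {w : Fin n → ℕ} (hw : ∀ k, 0 < w k) :
    StrictAnti (revPartialSum w) := by
  intro i j hij
  have hij' : (i : ℕ) < j := hij
  refine Finset.sum_lt_sum (fun k _ => ?_) ⟨i.rev, Finset.mem_univ _, ?_⟩
  · split_ifs <;> omega
  · rw [if_neg (by rw [Fin.val_rev]; omega), if_pos (by rw [Fin.val_rev]; omega)]
    exact hw _

theorem exists_revPartialSum_eq {n : ℕ} {u : Fin n → ℕ} (hu : StrictAnti u)
    (hpos : ∀ i, 0 < u i) : ∃ w : Fin n → ℕ, (∀ k, 0 < w k) ∧ revPartialSum w = u := by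
  induction n with
  | zero => exact ⟨u, hpos, Subsingleton.elim _ _⟩
  | succ n ih =>
    obtain ⟨w, hw, hwu⟩ := ih (u := Fin.tail u)
      (fun i j hij => hu (Fin.succ_lt_succ_iff.2 hij)) (fun i => hpos _)
    have hlt : ∑ k, w k < u 0 := by
      cases n with
      | zero => simpa using hpos 0
      | succ n =>
        have h0 : ∑ k, w k = u 1 := by
          have := congrFun hwu 0
          rw [← Fin.succ_zero_eq_one, ← show Fin.tail u 0 = u (Fin.succ 0) from rfl, ← this]
          simp [revPartialSum, Nat.lt_succ_iff.1 (Fin.is_lt _)]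
        rw [h0]
        exact hu Fin.zero_lt_one
    refine ⟨Fin.snoc (α := fun _ => ℕ) w (u 0 - ∑ k, w k), fun k => ?_, funext fun i => ?_⟩
    · induction k using Fin.lastCases with
      | last => rw [Fin.snoc_last]; omega
      | cast k => rw [Fin.snoc_castSucc]; exact hw k
    · induction i using Fin.cases with
      | zero => rw [revPartialSum_zero, Fin.init_snoc, Fin.snoc_last]; omega
      | succ i => rw [revPartialSum_succ, Fin.init_snoc, hwu]; rfl

theorem sum_revPartialSum_mul_comm {n : ℕ} (w v : Fin n → ℕ) :
    ∑ i, revPartialSum w i * v i = ∑ i, revPartialSum v i * w i := by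
  simp only [revPartialSum, Finset.sum_mul]
  rw [Finset.sum_comm]
  refine Finset.sum_congr rfl fun i _ => Finset.sum_congr rfl fun k _ => ?_
  rw [add_comm (i : ℕ), ite_mul, ite_mul, zero_mul, zero_mul, mul_comm]

/-- The index set of the coefficient of `q ^ N` in a bi-bracket of length `l`. -/
def biBracketIndex (l N : ℕ) : Set ((Fin l → ℕ) × (Fin l → ℕ)) :=
  {uv | StrictAnti uv.1 ∧ (∀ j, 0 < uv.1 j) ∧ (∀ j, 0 < uv.2 j) ∧ (∑ j, uv.1 j * uv.2 j) = N}

theorem finite_biBracketIndex (l N : ℕ) : (biBracketIndex l N).Finite := by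
  refine ((Set.finite_Iic fun _ : Fin l => N).prod (Set.finite_Iic fun _ : Fin l => N)).subset ?_
  rintro ⟨u, v⟩ ⟨-, hu, hv, hsum⟩
  have hle (i : Fin l) : u i * v i ≤ N :=
    hsum ▸ Finset.single_le_sum (f := fun j => u j * v j) (fun _ _ => Nat.zero_le _)
      (Finset.mem_univ i)
  exact ⟨fun i => (Nat.le_mul_of_pos_right _ (hv i)).trans (hle i),
    fun i => (Nat.le_mul_of_pos_left _ (hu i)).trans (hle i)⟩

/-- Pairs of positive tuples parametrizing `biBracketIndex` through `revPartialSum`. -/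
def biBracketParam (l N : ℕ) : Set ((Fin l → ℕ) × (Fin l → ℕ)) :=
  {wv | (∀ j, 0 < wv.1 j) ∧ (∀ j, 0 < wv.2 j) ∧ (∑ j, revPartialSum wv.1 j * wv.2 j) = N}

theorem bijOn_biBracketParam (l N : ℕ) :
    Set.BijOn (Prod.map revPartialSum id) (biBracketParam l N) (biBracketIndex l N) := by
  refine ⟨?_, ((revPartialSum_injective l).prodMap Function.injective_id).injOn, ?_⟩
  · rintro ⟨w, v⟩ ⟨hw, hv, hsum⟩
    exact ⟨strictAnti_revPartialSum hw, revPartialSum_pos hw, hv, hsum⟩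
  · rintro ⟨u, v⟩ ⟨hanti, hu, hv, hsum⟩
    obtain ⟨w, hw, rfl⟩ := exists_revPartialSum_eq hanti hu
    exact ⟨(w, v), ⟨hw, hv, hsum⟩, rfl⟩

theorem bijOn_swap_biBracketParam (l N : ℕ) :
    Set.BijOn Prod.swap (biBracketParam l N) (biBracketParam l N) := by
  have hmaps : Set.MapsTo Prod.swap (biBracketParam l N) (biBracketParam l N) := by
    rintro ⟨w, v⟩ ⟨hw, hv, hsum⟩
    exact ⟨hv, hw, (sum_revPartialSum_mul_comm v w).trans hsum⟩
  exact ⟨hmaps, Prod.swap_injective.injOn, fun p hp => ⟨p.swap, hmaps hp, p.swap_swap⟩⟩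

/-- Conjugation of partitions exchanges the parts with the partial sums of the multiplicities. -/
theorem finsum_fst_eq_finsum_revPartialSum_snd (l N : ℕ) (i : Fin l) :
    ∑ᶠ uv ∈ biBracketIndex l N, (uv.1 i : ℚ) =
      ∑ᶠ uv ∈ biBracketIndex l N, (revPartialSum uv.2 i : ℚ) := by
  rw [← finsum_mem_eq_of_bijOn (f := fun wv => (revPartialSum wv.1 i : ℚ)) _
      (bijOn_biBracketParam l N) (fun _ _ => rfl),
    ← finsum_mem_eq_of_bijOn (f := fun wv => (revPartialSum wv.2 i : ℚ)) _
      (bijOn_biBracketParam l N) (fun _ _ => rfl)]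
  exact finsum_mem_eq_of_bijOn _ (bijOn_swap_biBracketParam l N) (fun _ _ => rfl)

theorem coeff_biBracket (l : ℕ) (s r : Fin l → ℕ) (N : ℕ) :
    PowerSeries.coeff N (biBracket l s r) = ∑ᶠ uv ∈ biBracketIndex l N,
      ∏ j, ((uv.1 j : ℚ) ^ r j / (r j)!) * ((uv.2 j : ℚ) ^ (s j - 1) / ((s j - 1)!)) :=
  PowerSeries.coeff_mk _ _

/-- `[1,…,1; 0^{j−1},1,0^{n−j}] = ∑_{k=1}^{n−j+1} [1^{k−1}, 2, 1^{n−k}]`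
(positions are 1-based). -/
theorem biBracket_ones (n j : ℕ) (hj : 1 ≤ j) (hjn : j ≤ n) :
    biBracket n (fun _ => 1) (fun i => if (i : ℕ) + 1 = j then 1 else 0) =
      ∑ k ∈ Finset.Icc 1 (n - j + 1),
        biBracket n (fun i => if (i : ℕ) + 1 = k then 2 else 1) (fun _ => 0) := by
  have hprod (x : Fin n → ℕ) (i : Fin n) (k : ℕ) (hk : (i : ℕ) + 1 = k) :
      ∏ a : Fin n, (if (a : ℕ) + 1 = k then (x a : ℚ) else 1) = x i := by
    rw [Finset.prod_eq_single i (fun b _ hb => if_neg fun h => hb (Fin.ext (by omega)))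
      (fun h => absurd (Finset.mem_univ i) h), if_pos hk]
  ext N
  let i : Fin n := ⟨j - 1, by omega⟩
  rw [map_sum]
  simp only [coeff_biBracket]
  have hfin := finite_biBracketIndex n N
  calc _ = ∑ᶠ uv ∈ biBracketIndex n N, (uv.1 i : ℚ) := by
        refine finsum_mem_congr rfl fun uv _ => ?_
        rw [← hprod uv.1 i j (by simp only [i]; omega)]
        refine Finset.prod_congr rfl fun a _ => ?_
        split_ifs <;> simp
    _ = ∑ᶠ uv ∈ biBracketIndex n N, (revPartialSum uv.2 i : ℚ) :=
        finsum_fst_eq_finsum_revPartialSum_snd n N i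
    _ = _ := by
        simp only [finsum_mem_eq_finite_toFinset_sum _ hfin]
        rw [Finset.sum_comm]
        refine Finset.sum_congr rfl fun uv _ => ?_
        rw [revPartialSum, ← Finset.sum_filter, Nat.cast_sum]
        refine Finset.sum_bij (fun a _ => (a : ℕ) + 1) (fun a ha => ?_)
          (fun a _ b _ h => Fin.ext (Nat.succ_injective h)) (fun k hk => ?_) (fun a _ => ?_)
        · simp only [Finset.mem_filter, Finset.mem_univ, true_and, i] at ha
          rw [Finset.mem_Icc]
          omega
        · rw [Finset.mem_Icc] at hk
          refine ⟨⟨k - 1, by omega⟩, ?_, by simp only; omega⟩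
          simp only [Finset.mem_filter, Finset.mem_univ, true_and, i]
          omega
        · rw [← hprod uv.2 a _ rfl]
          refine Finset.prod_congr rfl fun b _ => ?_
          split_ifs <;> simp
end

section
/- For all integers s₁, s₂ ≥ 1, each of the bi-brackets [s₁,s₂; 1,0] and [s₁,s₂; 0,1] lies in the ℚ-vector subspace of ℚ[[q]] spanned by 1 together with the brackets [t₁,…,t_m] with 1 ≤ m ≤ 3, t₁,…,t_m ≥ 1 and t₁ + … + t_m ≤ s₁ + s₂ + 1. -/
open scoped Nat

namespace BiBracket
open Finset

/-- The power series whose `n`-th coefficient is the sum of a weight over the finite set `D n`. -/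
noncomputable def genSeries {α : Type*} (D : ℕ → Finset α) : (α → ℚ) →ₗ[ℚ] PowerSeries ℚ where
  toFun f := PowerSeries.mk fun n => ∑ p ∈ D n, f p
  map_add' f g := by ext n; simp [sum_add_distrib]
  map_smul' c f := by ext n; simp [mul_sum]

lemma coeff_genSeries {α : Type*} (D : ℕ → Finset α) (f : α → ℚ) (n : ℕ) :
    PowerSeries.coeff n (genSeries D f) = ∑ p ∈ D n, f p := by
  simp [genSeries]

lemma genSeries_congr {α : Type*} {D : ℕ → Finset α} {f g : α → ℚ}
    (h : ∀ n, ∀ p ∈ D n, f p = g p) : genSeries D f = genSeries D g := by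
  ext n; simp only [coeff_genSeries]; exact sum_congr rfl (h n)

lemma sum_trichotomy {α : Type*} (s : Finset α) (a b : α → ℕ) (f : α → ℚ) :
    ∑ p ∈ s, f p = ∑ p ∈ s with a p < b p, f p + ∑ p ∈ s with b p < a p, f p +
      ∑ p ∈ s with a p = b p, f p := by
  simp only [sum_filter, ← sum_add_distrib]
  refine sum_congr rfl fun p _ => ?_
  rcases lt_trichotomy (a p) (b p) with h | h | h
  · simp [h, h.not_gt, h.ne]
  · simp [h]
  · simp [h, h.not_gt, h.ne']

/-- Pairs `(u, v)` of positive integers with `u v = n`. -/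
def P1 (n : ℕ) : Finset (ℕ × ℕ) :=
  {p ∈ range (n + 1) ×ˢ range (n + 1) | 0 < p.1 ∧ 0 < p.2 ∧ p.1 * p.2 = n}

/-- Tuples `(u₁, v₁, u₂, v₂)` of positive integers with `u₁ v₁ + u₂ v₂ = n`. -/
def P2 (n : ℕ) : Finset (ℕ × ℕ × ℕ × ℕ) :=
  {p ∈ range (n + 1) ×ˢ range (n + 1) ×ˢ range (n + 1) ×ˢ range (n + 1) |
    0 < p.1 ∧ 0 < p.2.1 ∧ 0 < p.2.2.1 ∧ 0 < p.2.2.2 ∧ p.1 * p.2.1 + p.2.2.1 * p.2.2.2 = n}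

/-- Tuples `(u₁, v₁, u₂, v₂, u₃, v₃)` of positive integers with
`u₁ v₁ + u₂ v₂ + u₃ v₃ = n`. -/
def P3 (n : ℕ) : Finset (ℕ × ℕ × ℕ × ℕ × ℕ × ℕ) :=
  {p ∈ range (n + 1) ×ˢ range (n + 1) ×ˢ range (n + 1) ×ˢ range (n + 1) ×ˢ range (n + 1) ×ˢ
      range (n + 1) |
    0 < p.1 ∧ 0 < p.2.1 ∧ 0 < p.2.2.1 ∧ 0 < p.2.2.2.1 ∧ 0 < p.2.2.2.2.1 ∧ 0 < p.2.2.2.2.2 ∧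
      p.1 * p.2.1 + p.2.2.1 * p.2.2.2.1 + p.2.2.2.2.1 * p.2.2.2.2.2 = n}

/-- The tuples of `P2 n` with `u₁ > u₂`. -/
def D2 (n : ℕ) : Finset (ℕ × ℕ × ℕ × ℕ) := {p ∈ P2 n | p.2.2.1 < p.1}
/-- The tuples of `P3 n` with `u₁ > u₂`, and no condition on `u₃`. -/
def D21 (n : ℕ) : Finset (ℕ × ℕ × ℕ × ℕ × ℕ × ℕ) := {p ∈ P3 n | p.2.2.1 < p.1}
/-- The tuples of `P3 n` with `u₁ > u₂ > u₃`. -/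
def D3 (n : ℕ) : Finset (ℕ × ℕ × ℕ × ℕ × ℕ × ℕ) :=
  {p ∈ P3 n | p.2.2.1 < p.1 ∧ p.2.2.2.2.1 < p.2.2.1}

lemma mem_P1 {n u v : ℕ} : (u, v) ∈ P1 n ↔ 0 < u ∧ 0 < v ∧ u * v = n := by
  simp only [P1, mem_filter, mem_product, mem_range, and_iff_right_iff_imp]
  rintro ⟨h1, h2, h⟩
  constructor <;> nlinarith

lemma mem_P2 {n u₁ v₁ u₂ v₂ : ℕ} : (u₁, v₁, u₂, v₂) ∈ P2 n ↔
    0 < u₁ ∧ 0 < v₁ ∧ 0 < u₂ ∧ 0 < v₂ ∧ u₁ * v₁ + u₂ * v₂ = n := by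
  simp only [P2, mem_filter, mem_product, mem_range, and_iff_right_iff_imp]
  rintro ⟨h1, h2, h3, h4, h⟩
  refine ⟨?_, ?_, ?_, ?_⟩ <;> nlinarith

lemma mem_P3 {n u₁ v₁ u₂ v₂ u₃ v₃ : ℕ} : (u₁, v₁, u₂, v₂, u₃, v₃) ∈ P3 n ↔
    0 < u₁ ∧ 0 < v₁ ∧ 0 < u₂ ∧ 0 < v₂ ∧ 0 < u₃ ∧ 0 < v₃ ∧ u₁ * v₁ + u₂ * v₂ + u₃ * v₃ = n := by
  simp only [P3, mem_filter, mem_product, mem_range, and_iff_right_iff_imp]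
  rintro ⟨h1, h2, h3, h4, h5, h6, h⟩
  refine ⟨?_, ?_, ?_, ?_, ?_, ?_⟩ <;> nlinarith

lemma mem_D2 {n u₁ v₁ u₂ v₂ : ℕ} : (u₁, v₁, u₂, v₂) ∈ D2 n ↔
    (0 < u₁ ∧ 0 < v₁ ∧ 0 < u₂ ∧ 0 < v₂ ∧ u₁ * v₁ + u₂ * v₂ = n) ∧ u₂ < u₁ := by
  simp only [D2, mem_filter, mem_P2]

lemma mem_D21 {n u₁ v₁ u₂ v₂ u₃ v₃ : ℕ} : (u₁, v₁, u₂, v₂, u₃, v₃) ∈ D21 n ↔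
    (0 < u₁ ∧ 0 < v₁ ∧ 0 < u₂ ∧ 0 < v₂ ∧ 0 < u₃ ∧ 0 < v₃ ∧
      u₁ * v₁ + u₂ * v₂ + u₃ * v₃ = n) ∧ u₂ < u₁ := by
  simp only [D21, mem_filter, mem_P3]

lemma mem_D3 {n u₁ v₁ u₂ v₂ u₃ v₃ : ℕ} : (u₁, v₁, u₂, v₂, u₃, v₃) ∈ D3 n ↔
    (0 < u₁ ∧ 0 < v₁ ∧ 0 < u₂ ∧ 0 < v₂ ∧ 0 < u₃ ∧ 0 < v₃ ∧
      u₁ * v₁ + u₂ * v₂ + u₃ * v₃ = n) ∧ u₂ < u₁ ∧ u₃ < u₂ := by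
  simp only [D3, mem_filter, mem_P3]


/-- Stuffle product of two single sums. -/
lemma genSeries_P2 (g : ℕ × ℕ × ℕ × ℕ → ℚ) :
    genSeries P2 g = genSeries D2 g + genSeries D2 (fun p => g (p.2.2.1, p.2.2.2, p.1, p.2.1)) +
      genSeries P1 (fun p => ∑ x ∈ Ioo 0 p.2, g (p.1, x, p.1, p.2 - x)) := by
  ext n
  simp only [map_add, coeff_genSeries]
  rw [sum_trichotomy (P2 n) (fun p => p.2.2.1) (fun p => p.1)]
  congr 1
  · congr 1
    refine sum_nbij' (fun p => (p.2.2.1, p.2.2.2, p.1, p.2.1))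
      (fun p => (p.2.2.1, p.2.2.2, p.1, p.2.1)) ?_ ?_ ?_ ?_ ?_ <;>
    · simp only [Prod.forall, mem_filter, mem_P2, mem_D2]
      grind
  · rw [sum_sigma']
    refine sum_nbij' (fun p => ⟨(p.1, p.2.1 + p.2.2.2), p.2.1⟩)
      (fun p => (p.1.1, p.2, p.1.1, p.1.2 - p.2)) ?_ ?_ ?_ ?_ ?_
    · simp only [Prod.forall, mem_filter, mem_P2, mem_sigma, mem_P1, mem_Ioo]
      grind
    · rintro ⟨⟨u, v⟩, x⟩ h
      simp only [mem_filter, mem_P2, mem_sigma, mem_P1, mem_Ioo] at h ⊢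
      obtain ⟨y, rfl⟩ : ∃ y, v = x + y := ⟨v - x, by omega⟩
      grind
    · simp only [Prod.forall, mem_filter, mem_P2]
      grind
    · simp only [Sigma.forall, Prod.forall, mem_sigma, mem_P1, mem_Ioo]
      grind
    · simp only [Prod.forall, mem_filter, mem_P2]
      grind

/-- Stuffle product of a double sum with a single sum. -/
lemma genSeries_D21_stuffle (f : ℕ → ℕ → ℕ → ℚ) :
    genSeries D21 (fun p => f p.2.1 p.2.2.2.1 p.2.2.2.2.2) =
      genSeries D3 (fun p => f p.2.1 p.2.2.2.1 p.2.2.2.2.2) +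
      (genSeries D3 (fun p => f p.2.1 p.2.2.2.2.2 p.2.2.2.1) +
        genSeries D3 (fun p => f p.2.2.2.1 p.2.2.2.2.2 p.2.1) +
        genSeries D2 (fun p => ∑ x ∈ Ioo 0 p.2.1, f x p.2.2.2 (p.2.1 - x))) +
      genSeries D2 (fun p => ∑ x ∈ Ioo 0 p.2.2.2, f p.2.1 x (p.2.2.2 - x)) := by
  ext n
  simp only [map_add, coeff_genSeries]
  rw [sum_trichotomy (D21 n) (fun p => p.2.2.2.2.1) (fun p => p.2.2.1),
    sum_trichotomy {p ∈ D21 n | p.2.2.1 < p.2.2.2.2.1} (fun p => p.2.2.2.2.1) (fun p => p.1)]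
  congr 1
  · congr 1
    · refine sum_congr ?_ fun _ _ => rfl
      ext ⟨u₁, v₁, u₂, v₂, u₃, v₃⟩
      simp only [mem_filter, mem_D21, mem_D3]
      grind
    congr 1
    · congr 1
      · refine sum_nbij' (fun p => (p.1, p.2.1, p.2.2.2.2.1, p.2.2.2.2.2, p.2.2.1, p.2.2.2.1))
          (fun p => (p.1, p.2.1, p.2.2.2.2.1, p.2.2.2.2.2, p.2.2.1, p.2.2.2.1)) ?_ ?_ ?_ ?_ ?_ <;>
        · simp only [Prod.forall, mem_filter, mem_D21, mem_D3]
          grind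
      · refine sum_nbij' (fun p => (p.2.2.2.2.1, p.2.2.2.2.2, p.1, p.2.1, p.2.2.1, p.2.2.2.1))
          (fun p => (p.2.2.1, p.2.2.2.1, p.2.2.2.2.1, p.2.2.2.2.2, p.1, p.2.1)) ?_ ?_ ?_ ?_ ?_ <;>
        · simp only [Prod.forall, mem_filter, mem_D21, mem_D3]
          grind
    · rw [sum_sigma']
      refine sum_nbij'
        (fun p => ⟨(p.1, p.2.1 + p.2.2.2.2.2, p.2.2.1, p.2.2.2.1), p.2.1⟩)
        (fun p => (p.1.1, p.2, p.1.2.2.1, p.1.2.2.2, p.1.1, p.1.2.1 - p.2)) ?_ ?_ ?_ ?_ ?_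
      · simp only [Prod.forall, mem_filter, mem_D21, mem_sigma, mem_D2, mem_Ioo]
        grind
      · rintro ⟨⟨u₁, v₁, u₂, v₂⟩, x⟩ h
        simp only [mem_filter, mem_D21, mem_sigma, mem_D2, mem_Ioo] at h ⊢
        obtain ⟨y, rfl⟩ : ∃ y, v₁ = x + y := ⟨v₁ - x, by omega⟩
        grind
      · simp only [Prod.forall, mem_filter, mem_D21]
        grind
      · simp only [Sigma.forall, Prod.forall, mem_sigma, mem_D2, mem_Ioo]
        grind
      · simp only [Prod.forall, mem_filter, mem_D21]
        grind
  · rw [sum_sigma']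
    refine sum_nbij'
      (fun p => ⟨(p.1, p.2.1, p.2.2.1, p.2.2.2.1 + p.2.2.2.2.2), p.2.2.2.1⟩)
      (fun p => (p.1.1, p.1.2.1, p.1.2.2.1, p.2, p.1.2.2.1, p.1.2.2.2 - p.2)) ?_ ?_ ?_ ?_ ?_
    · simp only [Prod.forall, mem_filter, mem_D21, mem_sigma, mem_D2, mem_Ioo]
      grind
    · rintro ⟨⟨u₁, v₁, u₂, v₂⟩, x⟩ h
      simp only [mem_filter, mem_D21, mem_sigma, mem_D2, mem_Ioo] at h ⊢
      obtain ⟨y, rfl⟩ : ∃ y, v₂ = x + y := ⟨v₂ - x, by omega⟩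
      grind
    · simp only [Prod.forall, mem_filter, mem_D21]
      grind
    · simp only [Sigma.forall, Prod.forall, mem_sigma, mem_D2, mem_Ioo]
      grind
    · simp only [Prod.forall, mem_filter, mem_D21]
      grind

/-- Shuffle product of a double sum with the weight one sum. -/
lemma genSeries_D21_shuffle (f : ℕ → ℕ → ℚ) :
    genSeries D21 (fun p => f p.2.1 p.2.2.2.1) =
      genSeries D3 (fun p => f (p.2.1 + p.2.2.2.1) p.2.2.2.2.2) +
      (genSeries D3 (fun p => f p.2.1 (p.2.2.2.1 + p.2.2.2.2.2)) +
        genSeries D3 (fun p => f p.2.1 p.2.2.2.1) +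
        genSeries D2 (fun p => ((p.2.2.1 : ℚ) - 1) * f p.2.1 p.2.2.2)) +
      genSeries D2 (fun p => ((p.1 : ℚ) - p.2.2.1 - 1) * f p.2.1 p.2.2.2) := by
  ext n
  simp only [map_add, coeff_genSeries]
  rw [sum_trichotomy (D21 n) (fun p => p.2.2.2.2.2) (fun p => p.2.1),
    sum_trichotomy {p ∈ D21 n | p.2.1 < p.2.2.2.2.2} (fun p => p.2.2.2.2.2)
      (fun p => p.2.1 + p.2.2.2.1)]
  congr 1
  · congr 1
    · refine sum_nbij' (fun p => (p.2.2.2.2.1 + p.1, p.2.2.2.2.2, p.1, p.2.1 - p.2.2.2.2.2,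
          p.2.2.1, p.2.2.2.1))
        (fun p => (p.2.2.1, p.2.1 + p.2.2.2.1, p.2.2.2.2.1, p.2.2.2.2.2, p.1 - p.2.2.1, p.2.1))
        ?_ ?_ ?_ ?_ ?_
      · rintro ⟨u₁, v₁, u₂, v₂, w, x⟩ h
        simp only [mem_filter, mem_D21, mem_D3] at h ⊢
        obtain ⟨y, rfl⟩ : ∃ y, v₁ = x + y := ⟨v₁ - x, by omega⟩
        grind
      · rintro ⟨u₁, v₁, u₂, v₂, u₃, v₃⟩ h
        simp only [mem_filter, mem_D21, mem_D3] at h ⊢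
        obtain ⟨y, rfl⟩ : ∃ y, u₁ = u₂ + y := ⟨u₁ - u₂, by omega⟩
        grind
      all_goals
        simp only [Prod.forall, mem_filter, mem_D21, mem_D3]
        grind
    congr 1
    · congr 1
      · refine sum_nbij' (fun p => (p.2.2.2.2.1 + p.1, p.2.1, p.2.2.2.2.1 + p.2.2.1,
            p.2.2.2.2.2 - p.2.1, p.2.2.1, p.2.1 + p.2.2.2.1 - p.2.2.2.2.2))
          (fun p => (p.1 - (p.2.2.1 - p.2.2.2.2.1), p.2.1, p.2.2.2.2.1, p.2.2.2.1 + p.2.2.2.2.2,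
            p.2.2.1 - p.2.2.2.2.1, p.2.1 + p.2.2.2.1))
          ?_ ?_ ?_ ?_ ?_
        · rintro ⟨u₁, v₁, u₂, v₂, w, x⟩ h
          simp only [mem_filter, mem_D21, mem_D3] at h ⊢
          obtain ⟨y, rfl⟩ : ∃ y, x = v₁ + y := ⟨x - v₁, by omega⟩
          obtain ⟨z, rfl⟩ : ∃ z, v₂ = y + z := ⟨v₂ - y, by omega⟩
          rw [show v₁ + (y + z) - (v₁ + y) = z by omega, Nat.add_sub_cancel_left]
          grind
        · rintro ⟨u₁, v₁, u₂, v₂, u₃, v₃⟩ h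
          simp only [mem_filter, mem_D21, mem_D3] at h ⊢
          obtain ⟨y, rfl⟩ : ∃ y, u₂ = u₃ + y := ⟨u₂ - u₃, by omega⟩
          obtain ⟨z, rfl⟩ : ∃ z, u₁ = y + z := ⟨u₁ - y, by omega⟩
          rw [show u₃ + y - u₃ = y by omega, Nat.add_sub_cancel_left]
          grind
        all_goals
          simp only [Prod.forall, mem_filter, mem_D21, mem_D3]
          grind
      · refine sum_nbij' (fun p => (p.2.2.2.2.1 + p.1, p.2.1, p.2.2.2.2.1 + p.2.2.1,
            p.2.2.2.1, p.2.2.2.2.1, p.2.2.2.2.2 - (p.2.1 + p.2.2.2.1)))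
          (fun p => (p.1 - p.2.2.2.2.1, p.2.1, p.2.2.1 - p.2.2.2.2.1, p.2.2.2.1,
            p.2.2.2.2.1, p.2.1 + p.2.2.2.1 + p.2.2.2.2.2))
          ?_ ?_ ?_ ?_ ?_
        · rintro ⟨u₁, v₁, u₂, v₂, w, x⟩ h
          simp only [mem_filter, mem_D21, mem_D3] at h ⊢
          obtain ⟨y, rfl⟩ : ∃ y, x = v₁ + v₂ + y := ⟨x - (v₁ + v₂), by omega⟩
          rw [Nat.add_sub_cancel_left]
          grind
        · rintro ⟨u₁, v₁, u₂, v₂, u₃, v₃⟩ h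
          simp only [mem_filter, mem_D21, mem_D3] at h ⊢
          obtain ⟨y, rfl⟩ : ∃ y, u₂ = u₃ + y := ⟨u₂ - u₃, by omega⟩
          obtain ⟨z, rfl⟩ : ∃ z, u₁ = u₃ + z := ⟨u₁ - u₃, by omega⟩
          rw [Nat.add_sub_cancel_left, Nat.add_sub_cancel_left]
          grind
        all_goals
          simp only [Prod.forall, mem_filter, mem_D21, mem_D3]
          grind
    · trans ∑ p ∈ D2 n, ∑ w ∈ Ioo 0 p.2.2.1, f p.2.1 p.2.2.2
      · rw [sum_sigma']
        refine sum_nbij'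
          (fun p => ⟨(p.2.2.2.2.1 + p.1, p.2.1, p.2.2.2.2.1 + p.2.2.1, p.2.2.2.1), p.2.2.2.2.1⟩)
          (fun p => (p.1.1 - p.2, p.1.2.1, p.1.2.2.1 - p.2, p.1.2.2.2, p.2,
            p.1.2.1 + p.1.2.2.2)) ?_ ?_ ?_ ?_ ?_
        · simp only [Prod.forall, mem_filter, mem_D21, mem_sigma, mem_D2, mem_Ioo]
          grind
        · rintro ⟨⟨u₁, v₁, u₂, v₂⟩, w⟩ h
          simp only [mem_filter, mem_D21, mem_sigma, mem_D2, mem_Ioo] at h ⊢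
          obtain ⟨y, rfl⟩ : ∃ y, u₂ = w + y := ⟨u₂ - w, by omega⟩
          obtain ⟨z, rfl⟩ : ∃ z, u₁ = w + z := ⟨u₁ - w, by omega⟩
          rw [Nat.add_sub_cancel_left, Nat.add_sub_cancel_left]
          grind
        · simp only [Prod.forall, mem_filter, mem_D21]
          grind
        · simp only [Sigma.forall, Prod.forall, mem_sigma, mem_D2, mem_Ioo]
          grind
        · simp only [Prod.forall, mem_filter, mem_D21]
          grind
      · refine sum_congr rfl ?_
        rintro ⟨u₁, v₁, u₂, v₂⟩ h
        rw [mem_D2] at h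
        dsimp only
        rw [sum_const, Nat.card_Ioo, nsmul_eq_mul, Nat.sub_zero, Nat.cast_sub (by omega)]
        simp
  · trans ∑ p ∈ D2 n, ∑ w ∈ Ioo 0 (p.1 - p.2.2.1), f p.2.1 p.2.2.2
    · rw [sum_sigma']
      refine sum_nbij'
        (fun p => ⟨(p.2.2.2.2.1 + p.1, p.2.1, p.2.2.1, p.2.2.2.1), p.2.2.2.2.1⟩)
        (fun p => (p.1.1 - p.2, p.1.2.1, p.1.2.2.1, p.1.2.2.2, p.2, p.1.2.1)) ?_ ?_ ?_ ?_ ?_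
      · simp only [Prod.forall, mem_filter, mem_D21, mem_sigma, mem_D2, mem_Ioo]
        grind
      · rintro ⟨⟨u₁, v₁, u₂, v₂⟩, w⟩ h
        simp only [mem_filter, mem_D21, mem_sigma, mem_D2, mem_Ioo] at h ⊢
        obtain ⟨z, rfl⟩ : ∃ z, u₁ = w + z := ⟨u₁ - w, by omega⟩
        rw [Nat.add_sub_cancel_left]
        grind
      · simp only [Prod.forall, mem_filter, mem_D21]
        grind
      · simp only [Sigma.forall, Prod.forall, mem_sigma, mem_D2, mem_Ioo]
        grind
      · simp only [Prod.forall, mem_filter, mem_D21]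
        grind
    · refine sum_congr rfl ?_
      rintro ⟨u₁, v₁, u₂, v₂⟩ h
      rw [mem_D2] at h
      dsimp only
      rw [sum_const, Nat.card_Ioo, nsmul_eq_mul, Nat.sub_zero, Nat.cast_sub (by omega),
        Nat.cast_sub (by omega)]
      simp

/-- Shuffle product of a single sum with the weight one sum. -/
lemma genSeries_P2_shuffle (f : ℕ → ℚ) :
    genSeries P2 (fun p => f p.2.1) =
      genSeries D2 (fun p => f p.2.1) + genSeries D2 (fun p => f (p.2.1 + p.2.2.2)) +
      genSeries P1 (fun p => ((p.1 : ℚ) - 1) * f p.2) := by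
  ext n
  simp only [map_add, coeff_genSeries]
  rw [sum_trichotomy (P2 n) (fun p => p.2.1) (fun p => p.2.2.2)]
  congr 1
  · congr 1
    · refine sum_nbij' (fun p => (p.1 + p.2.2.1, p.2.1, p.2.2.1, p.2.2.2 - p.2.1))
        (fun p => (p.1 - p.2.2.1, p.2.1, p.2.2.1, p.2.1 + p.2.2.2)) ?_ ?_ ?_ ?_ ?_
      · rintro ⟨u, v, w, x⟩ h
        simp only [mem_filter, mem_P2, mem_D2] at h ⊢
        obtain ⟨y, rfl⟩ : ∃ y, x = v + y := ⟨x - v, by omega⟩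
        grind
      · rintro ⟨u, v, w, x⟩ h
        simp only [mem_filter, mem_P2, mem_D2] at h ⊢
        obtain ⟨y, rfl⟩ : ∃ y, u = w + y := ⟨u - w, by omega⟩
        grind
      all_goals
        simp only [Prod.forall, mem_filter, mem_P2, mem_D2]
        grind
    · refine sum_nbij' (fun p => (p.1 + p.2.2.1, p.2.2.2, p.1, p.2.1 - p.2.2.2))
        (fun p => (p.2.2.1, p.2.1 + p.2.2.2, p.1 - p.2.2.1, p.2.1)) ?_ ?_ ?_ ?_ ?_
      · rintro ⟨u, v, w, x⟩ h
        simp only [mem_filter, mem_P2, mem_D2] at h ⊢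
        obtain ⟨y, rfl⟩ : ∃ y, v = x + y := ⟨v - x, by omega⟩
        grind
      · rintro ⟨u, v, w, x⟩ h
        simp only [mem_filter, mem_P2, mem_D2] at h ⊢
        obtain ⟨y, rfl⟩ : ∃ y, u = w + y := ⟨u - w, by omega⟩
        grind
      all_goals
        simp only [Prod.forall, mem_filter, mem_P2, mem_D2]
        grind
  · trans ∑ p ∈ P1 n, ∑ w ∈ Ioo 0 p.1, f p.2
    · rw [sum_sigma']
      refine sum_nbij' (fun p => ⟨(p.2.2.1 + p.1, p.2.1), p.2.2.1⟩)
        (fun p => (p.1.1 - p.2, p.1.2, p.2, p.1.2)) ?_ ?_ ?_ ?_ ?_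
      · simp only [Prod.forall, mem_filter, mem_P2, mem_sigma, mem_P1, mem_Ioo]
        grind
      · rintro ⟨⟨u, v⟩, w⟩ h
        simp only [mem_filter, mem_P2, mem_sigma, mem_P1, mem_Ioo] at h ⊢
        obtain ⟨z, rfl⟩ : ∃ z, u = w + z := ⟨u - w, by omega⟩
        grind
      · simp only [Prod.forall, mem_filter, mem_P2]
        grind
      · simp only [Sigma.forall, Prod.forall, mem_sigma, mem_P1, mem_Ioo]
        grind
      · simp only [Prod.forall, mem_filter, mem_P2]
        grind
    · refine sum_congr rfl ?_
      rintro ⟨u, v⟩ h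
      rw [mem_P1] at h
      dsimp only
      rw [sum_const, Nat.card_Ioo, nsmul_eq_mul, Nat.sub_zero, Nat.cast_sub (by omega)]
      simp

lemma genSeries_P1_mul (f g : ℕ × ℕ → ℚ) :
    genSeries P1 f * genSeries P1 g = genSeries P2 (fun p => f (p.1, p.2.1) * g p.2.2) := by
  ext n
  simp only [PowerSeries.coeff_mul, coeff_genSeries, sum_mul_sum, ← sum_product']
  rw [sum_sigma']
  refine sum_nbij' (fun p => (p.2.1.1, p.2.1.2, p.2.2))
    (fun p => ⟨(p.1 * p.2.1, p.2.2.1 * p.2.2.2), (p.1, p.2.1), p.2.2⟩) ?_ ?_ ?_ ?_ ?_ <;>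
  · simp only [Sigma.forall, Prod.forall, mem_sigma, mem_product, HasAntidiagonal.mem_antidiagonal, mem_P1, mem_P2]
    grind

lemma genSeries_D2_mul (f : ℕ × ℕ × ℕ × ℕ → ℚ) (g : ℕ × ℕ → ℚ) :
    genSeries D2 f * genSeries P1 g =
      genSeries D21 (fun p => f (p.1, p.2.1, p.2.2.1, p.2.2.2.1) * g p.2.2.2.2) := by
  ext n
  simp only [PowerSeries.coeff_mul, coeff_genSeries, sum_mul_sum, ← sum_product']
  rw [sum_sigma']
  refine sum_nbij' (fun p => (p.2.1.1, p.2.1.2.1, p.2.1.2.2.1, p.2.1.2.2.2, p.2.2))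
    (fun p => ⟨(p.1 * p.2.1 + p.2.2.1 * p.2.2.2.1, p.2.2.2.2.1 * p.2.2.2.2.2),
      (p.1, p.2.1, p.2.2.1, p.2.2.2.1), p.2.2.2.2⟩) ?_ ?_ ?_ ?_ ?_ <;>
  · simp only [Sigma.forall, Prod.forall, mem_sigma, mem_product, HasAntidiagonal.mem_antidiagonal, mem_P1, mem_D2,
      mem_D21]
    grind

lemma biBracket_one (s r : Fin 1 → ℕ) :
    biBracket 1 s r = genSeries P1 (fun p =>
      ((p.1 : ℚ) ^ r 0 / (r 0)!) * ((p.2 : ℚ) ^ (s 0 - 1) / (s 0 - 1)!)) := by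
  ext n
  rw [coeff_genSeries, biBracket, PowerSeries.coeff_mk, ← finsum_mem_coe_finset]
  symm
  refine finsum_mem_eq_of_bijOn (fun p => (![p.1], ![p.2])) ⟨?_, ?_, ?_⟩ ?_
  · rintro ⟨u, v⟩ h
    rw [mem_coe, mem_P1] at h
    simp [h, Subsingleton.strictAnti]
  · rintro ⟨u, v⟩ - ⟨u', v'⟩ - h
    simp_all
  · rintro ⟨u, v⟩ h
    refine ⟨(u 0, v 0), ?_, ?_⟩
    · rw [mem_coe, mem_P1]
      simpa using h.2
    · ext i <;> fin_cases i <;> rfl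
  · rintro ⟨u, v⟩ -
    simp

lemma biBracket_two (s r : Fin 2 → ℕ) :
    biBracket 2 s r = genSeries D2 (fun p =>
      ((p.1 : ℚ) ^ r 0 / (r 0)!) * ((p.2.1 : ℚ) ^ (s 0 - 1) / (s 0 - 1)!) *
        (((p.2.2.1 : ℚ) ^ r 1 / (r 1)!) * ((p.2.2.2 : ℚ) ^ (s 1 - 1) / (s 1 - 1)!))) := by
  ext n
  rw [coeff_genSeries, biBracket, PowerSeries.coeff_mk, ← finsum_mem_coe_finset]
  symm
  refine finsum_mem_eq_of_bijOn (fun p => (![p.1, p.2.2.1], ![p.2.1, p.2.2.2])) ⟨?_, ?_, ?_⟩ ?_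
  · rintro ⟨u₁, v₁, u₂, v₂⟩ h
    rw [mem_coe, mem_D2] at h
    simp [h, Fin.strictAnti_iff_succ_lt]
  · rintro ⟨u₁, v₁, u₂, v₂⟩ - ⟨u₁', v₁', u₂', v₂'⟩ - h
    simp_all
  · rintro ⟨u, v⟩ h
    refine ⟨(u 0, v 0, u 1, v 1), ?_, ?_⟩
    · rw [mem_coe, mem_D2]
      simp only [Set.mem_ofPred_eq, Fin.strictAnti_iff_succ_lt, Fin.forall_fin_two,
        Fin.sum_univ_two] at h
      simp at h
      grind
    · ext i <;> fin_cases i <;> rfl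
  · rintro ⟨u₁, v₁, u₂, v₂⟩ -
    simp [Fin.prod_univ_two]

lemma biBracket_three (s r : Fin 3 → ℕ) :
    biBracket 3 s r = genSeries D3 (fun p =>
      ((p.1 : ℚ) ^ r 0 / (r 0)!) * ((p.2.1 : ℚ) ^ (s 0 - 1) / (s 0 - 1)!) *
        (((p.2.2.1 : ℚ) ^ r 1 / (r 1)!) * ((p.2.2.2.1 : ℚ) ^ (s 1 - 1) / (s 1 - 1)!)) *
        (((p.2.2.2.2.1 : ℚ) ^ r 2 / (r 2)!) *
          ((p.2.2.2.2.2 : ℚ) ^ (s 2 - 1) / (s 2 - 1)!))) := by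
  ext n
  rw [coeff_genSeries, biBracket, PowerSeries.coeff_mk, ← finsum_mem_coe_finset]
  symm
  refine finsum_mem_eq_of_bijOn (fun p => (![p.1, p.2.2.1, p.2.2.2.2.1],
    ![p.2.1, p.2.2.2.1, p.2.2.2.2.2])) ⟨?_, ?_, ?_⟩ ?_
  · rintro ⟨u₁, v₁, u₂, v₂, u₃, v₃⟩ h
    rw [mem_coe, mem_D3] at h
    simp [h, Fin.strictAnti_iff_succ_lt, Fin.forall_fin_succ, Fin.sum_univ_three]
  · rintro ⟨u₁, v₁, u₂, v₂, u₃, v₃⟩ - ⟨u₁', v₁', u₂', v₂', u₃', v₃'⟩ - h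
    simp_all
  · rintro ⟨u, v⟩ h
    refine ⟨(u 0, v 0, u 1, v 1, u 2, v 2), ?_, ?_⟩
    · rw [mem_coe, mem_D3]
      simp [Fin.strictAnti_iff_succ_lt, Fin.forall_fin_succ,
        Fin.sum_univ_three] at h
      grind
    · ext i <;> fin_cases i <;> rfl
  · rintro ⟨u₁, v₁, u₂, v₂, u₃, v₃⟩ -
    simp [Fin.prod_univ_three]

/-- The span of `1` and the brackets of length at most `3` and weight at most `K`. -/
noncomputable def MD (K : ℕ) : Submodule ℚ (PowerSeries ℚ) :=
  Submodule.span ℚ ({(1 : PowerSeries ℚ)} ∪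
    {f | ∃ (m : ℕ) (t : Fin m → ℕ), 1 ≤ m ∧ m ≤ 3 ∧ (∀ j, 1 ≤ t j) ∧
      (∑ j, t j) ≤ K ∧ f = biBracket m t fun _ => 0})

lemma genSeries_P1_monomial_mem {K i : ℕ} (h : i + 1 ≤ K) :
    genSeries P1 (fun p => (p.2 : ℚ) ^ i) ∈ MD K := by
  have : genSeries P1 (fun p => (p.2 : ℚ) ^ i) =
      (i ! : ℚ) • biBracket 1 ![i + 1] fun _ => 0 := by
    rw [biBracket_one, ← map_smul]
    refine congrArg _ (funext fun p => ?_)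
    have := i.factorial_ne_zero
    simp
    field_simp
  rw [this]
  refine Submodule.smul_mem _ _ (Submodule.subset_span (Or.inr ⟨1, _, ?_, ?_, ?_, ?_, rfl⟩))
  all_goals simp [h]

lemma genSeries_D2_monomial_mem {K i j : ℕ} (h : i + j + 2 ≤ K) :
    genSeries D2 (fun p => (p.2.1 : ℚ) ^ i * (p.2.2.2 : ℚ) ^ j) ∈ MD K := by
  have : genSeries D2 (fun p => (p.2.1 : ℚ) ^ i * (p.2.2.2 : ℚ) ^ j) =
      ((i ! : ℚ) * j !) • biBracket 2 ![i + 1, j + 1] fun _ => 0 := by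
    rw [biBracket_two, ← map_smul]
    refine congrArg _ (funext fun p => ?_)
    have := i.factorial_ne_zero
    have := j.factorial_ne_zero
    simp
    field_simp
  rw [this]
  refine Submodule.smul_mem _ _ (Submodule.subset_span (Or.inr ⟨2, _, ?_, ?_, ?_, ?_, rfl⟩))
  · simp
  · simp
  · simp [Fin.forall_fin_two]
  · simp [Fin.sum_univ_two]
    omega

lemma genSeries_D3_monomial_mem {K i j k : ℕ} (h : i + j + k + 3 ≤ K) :
    genSeries D3 (fun p => (p.2.1 : ℚ) ^ i * (p.2.2.2.1 : ℚ) ^ j * (p.2.2.2.2.2 : ℚ) ^ k) ∈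
      MD K := by
  have : genSeries D3 (fun p =>
      (p.2.1 : ℚ) ^ i * (p.2.2.2.1 : ℚ) ^ j * (p.2.2.2.2.2 : ℚ) ^ k) =
      ((i ! : ℚ) * j ! * k !) • biBracket 3 ![i + 1, j + 1, k + 1] fun _ => 0 := by
    rw [biBracket_three, ← map_smul]
    refine congrArg _ (funext fun p => ?_)
    have := i.factorial_ne_zero
    have := j.factorial_ne_zero
    have := k.factorial_ne_zero
    simp
    field_simp
  rw [this]
  refine Submodule.smul_mem _ _ (Submodule.subset_span (Or.inr ⟨3, _, ?_, ?_, ?_, ?_, rfl⟩))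
  · simp
  · simp
  · simp [Fin.forall_fin_succ]
  · simp [Fin.sum_univ_three]
    omega

open Polynomial in
lemma exists_polynomial_sum_pow (i : ℕ) : ∃ p : ℚ[X], p.natDegree ≤ i + 1 ∧
    ∀ v : ℕ, 0 < v → ∑ x ∈ Ioo 0 v, (x : ℚ) ^ i = p.eval (v : ℚ) := by
  refine ⟨∑ k ∈ range (i + 1), C (_root_.bernoulli k * ((i + 1).choose k) / (i + 1)) * X ^ (i + 1 - k) -
    C (0 ^ i), ?_, fun v hv => ?_⟩
  · refine (natDegree_sub_le _ _).trans (max_le ?_ (by simp))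
    refine natDegree_sum_le_of_forall_le _ _ fun k _ => (natDegree_C_mul_X_pow_le _ _).trans ?_
    omega
  · have h1 : ∑ x ∈ range v, (x : ℚ) ^ i = 0 ^ i + ∑ x ∈ Ioo 0 v, (x : ℚ) ^ i := by
      have h2 : range v = insert 0 (Ioo 0 v) := by
        ext x
        simp only [mem_insert, mem_range, mem_Ioo]
        omega
      rw [h2, sum_insert (by simp), Nat.cast_zero]
    rw [eval_sub, eval_finsetSum, eval_C, eq_sub_iff_add_eq', ← h1, sum_range_pow]
    refine sum_congr rfl fun k _ => ?_
    simp
    ring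

open Polynomial in
lemma exists_polynomial_sum_pow_mul_pow (i j : ℕ) : ∃ p : ℚ[X], p.natDegree ≤ i + j + 1 ∧
    ∀ v : ℕ, 0 < v → ∑ x ∈ Ioo 0 v, (x : ℚ) ^ i * ((v - x : ℕ) : ℚ) ^ j = p.eval (v : ℚ) := by
  induction j generalizing i with
  | zero => simpa using exists_polynomial_sum_pow i
  | succ j ih =>
    obtain ⟨p, hp, hp'⟩ := ih i
    obtain ⟨q, hq, hq'⟩ := ih (i + 1)
    refine ⟨X * p - q, ?_, fun v hv => ?_⟩
    · refine (natDegree_sub_le _ _).trans (max_le (natDegree_mul_le.trans ?_) (by omega))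
      have := natDegree_X_le (R := ℚ)
      omega
    · rw [eval_sub, eval_mul, eval_X, ← hp' v hv, ← hq' v hv, mul_sum, ← sum_sub_distrib]
      refine sum_congr rfl fun x hx => ?_
      rw [mem_Ioo] at hx
      rw [Nat.cast_sub hx.2.le]
      ring

open Polynomial in
lemma genSeries_P1_eval_mem {K : ℕ} {p : ℚ[X]} (h : p.natDegree + 1 ≤ K) :
    genSeries P1 (fun t => p.eval (t.2 : ℚ)) ∈ MD K := by
  have : (fun t : ℕ × ℕ => p.eval (t.2 : ℚ)) =
      ∑ m ∈ range (p.natDegree + 1), p.coeff m • fun t : ℕ × ℕ => (t.2 : ℚ) ^ m := by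
    ext t
    simp [eval_eq_sum_range]
  rw [this, map_sum]
  refine Submodule.sum_mem _ fun m hm => ?_
  rw [mem_range] at hm
  rw [map_smul]
  exact Submodule.smul_mem _ _ (genSeries_P1_monomial_mem (by omega))

open Polynomial in
lemma genSeries_D2_eval_mem {K : ℕ} {p q : ℚ[X]} (h : p.natDegree + q.natDegree + 2 ≤ K) :
    genSeries D2 (fun t => p.eval (t.2.1 : ℚ) * q.eval (t.2.2.2 : ℚ)) ∈ MD K := by
  have : (fun t : ℕ × ℕ × ℕ × ℕ => p.eval (t.2.1 : ℚ) * q.eval (t.2.2.2 : ℚ)) =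
      ∑ m ∈ range (p.natDegree + 1), ∑ k ∈ range (q.natDegree + 1),
        (p.coeff m * q.coeff k) •
          fun t : ℕ × ℕ × ℕ × ℕ => (t.2.1 : ℚ) ^ m * (t.2.2.2 : ℚ) ^ k := by
    ext t
    simp only [eval_eq_sum_range, sum_mul_sum, Finset.sum_apply, Pi.smul_apply, smul_eq_mul]
    exact sum_congr rfl fun m _ => sum_congr rfl fun k _ => by ring
  rw [this, map_sum]
  refine Submodule.sum_mem _ fun m hm => ?_
  rw [map_sum]
  refine Submodule.sum_mem _ fun k hk => ?_
  rw [mem_range] at hm hk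
  rw [map_smul]
  exact Submodule.smul_mem _ _ (genSeries_D2_monomial_mem (by omega))

lemma genSeries_D21_monomial_mem {K i j k : ℕ} (h : i + j + k + 3 ≤ K) :
    genSeries D21 (fun p => (p.2.1 : ℚ) ^ i * (p.2.2.2.1 : ℚ) ^ j * (p.2.2.2.2.2 : ℚ) ^ k) ∈
      MD K := by
  rw [genSeries_D21_stuffle (fun x y z => (x : ℚ) ^ i * (y : ℚ) ^ j * (z : ℚ) ^ k)]
  obtain ⟨p, hp, hp'⟩ := exists_polynomial_sum_pow_mul_pow i k
  obtain ⟨q, hq, hq'⟩ := exists_polynomial_sum_pow_mul_pow j k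
  refine add_mem (add_mem (genSeries_D3_monomial_mem h) (add_mem (add_mem ?_ ?_) ?_)) ?_
  · convert genSeries_D3_monomial_mem (i := i) (j := k) (k := j) (K := K) (by omega) using 3
    ring
  · convert genSeries_D3_monomial_mem (i := k) (j := i) (k := j) (K := K) (by omega) using 3
    ring
  · convert genSeries_D2_eval_mem (p := p) (q := .X ^ j) (K := K) (by simp; omega) using 1
    refine genSeries_congr fun n => ?_
    rintro ⟨u₁, v₁, u₂, v₂⟩ h
    rw [mem_D2] at h
    simp only [← hp' v₁ h.1.2.1, sum_mul, Polynomial.eval_pow, Polynomial.eval_X]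
    exact sum_congr rfl fun x _ => by ring
  · convert genSeries_D2_eval_mem (p := .X ^ i) (q := q) (K := K) (by simp; omega) using 1
    refine genSeries_congr fun n => ?_
    rintro ⟨u₁, v₁, u₂, v₂⟩ h
    rw [mem_D2] at h
    simp only [← hq' v₂ h.1.2.2.2.1, mul_sum, Polynomial.eval_pow, Polynomial.eval_X]
    exact sum_congr rfl fun x _ => by ring

lemma genSeries_add_pow_mul_mem {α : Type*} {D : ℕ → Finset α} (M : Submodule ℚ (PowerSeries ℚ))
    (a b c : α → ℕ) {i j : ℕ}
    (h : ∀ k l, k + l = i →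
      genSeries D (fun p => (a p : ℚ) ^ k * (b p : ℚ) ^ l * (c p : ℚ) ^ j) ∈ M) :
    genSeries D (fun p => ((a p + b p : ℕ) : ℚ) ^ i * (c p : ℚ) ^ j) ∈ M := by
  have : (fun p => ((a p + b p : ℕ) : ℚ) ^ i * (c p : ℚ) ^ j) =
      ∑ m ∈ range (i + 1), (i.choose m : ℚ) •
        fun p => (a p : ℚ) ^ m * (b p : ℚ) ^ (i - m) * (c p : ℚ) ^ j := by
    ext p
    simp only [Nat.cast_add, add_pow, sum_mul, Finset.sum_apply, Pi.smul_apply, smul_eq_mul]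
    exact sum_congr rfl fun m _ => by ring
  rw [this, map_sum]
  refine Submodule.sum_mem _ fun m hm => ?_
  rw [mem_range] at hm
  rw [map_smul]
  exact Submodule.smul_mem _ _ (h _ _ (by omega))

/-- Up to a factorial factor, `[a + 1, b + 1; 1, 0]` is a combination of brackets. -/
lemma genSeries_D2_fst_mul_mem (a b : ℕ) :
    genSeries D2 (fun p => (p.1 : ℚ) * ((p.2.1 : ℚ) ^ a * (p.2.2.2 : ℚ) ^ b)) ∈
      MD (a + b + 3) := by
  have key := genSeries_D21_shuffle (fun x y => (x : ℚ) ^ a * (y : ℚ) ^ b)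
  have h0 : genSeries D21 (fun p => (p.2.1 : ℚ) ^ a * (p.2.2.2.1 : ℚ) ^ b) ∈ MD (a + b + 3) := by
    simpa using genSeries_D21_monomial_mem (i := a) (j := b) (k := 0) (K := a + b + 3) le_rfl
  have h1 : genSeries D3 (fun p => (p.2.1 : ℚ) ^ a * (p.2.2.2.1 : ℚ) ^ b) ∈ MD (a + b + 3) := by
    simpa using genSeries_D3_monomial_mem (i := a) (j := b) (k := 0) (K := a + b + 3) le_rfl
  have h2 : genSeries D3 (fun p => ((p.2.1 + p.2.2.2.1 : ℕ) : ℚ) ^ a * (p.2.2.2.2.2 : ℚ) ^ b) ∈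
      MD (a + b + 3) :=
    genSeries_add_pow_mul_mem _ _ _ _ fun k l hkl => genSeries_D3_monomial_mem (by omega)
  have h3 : genSeries D3 (fun p => (p.2.1 : ℚ) ^ a * ((p.2.2.2.1 + p.2.2.2.2.2 : ℕ) : ℚ) ^ b) ∈
      MD (a + b + 3) := by
    simp only [mul_comm (_ ^ a)]
    refine genSeries_add_pow_mul_mem _ _ _ _ fun k l hkl => ?_
    simp only [mul_comm _ (_ ^ a), ← mul_assoc]
    exact genSeries_D3_monomial_mem (by omega)
  have h4 : genSeries D2 (fun p => (p.2.1 : ℚ) ^ a * (p.2.2.2 : ℚ) ^ b) ∈ MD (a + b + 3) :=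
    genSeries_D2_monomial_mem (by omega)
  have h5 : genSeries D2 (fun p => (p.1 : ℚ) * ((p.2.1 : ℚ) ^ a * (p.2.2.2 : ℚ) ^ b)) =
      genSeries D2 (fun p => ((p.2.2.1 : ℚ) - 1) * ((p.2.1 : ℚ) ^ a * (p.2.2.2 : ℚ) ^ b)) +
      genSeries D2 (fun p =>
        ((p.1 : ℚ) - p.2.2.1 - 1) * ((p.2.1 : ℚ) ^ a * (p.2.2.2 : ℚ) ^ b)) +
      (2 : ℚ) • genSeries D2 (fun p => (p.2.1 : ℚ) ^ a * (p.2.2.2 : ℚ) ^ b) := by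
    rw [← map_smul, ← map_add, ← map_add]
    refine congrArg _ (funext fun p => ?_)
    simp
    ring
  rw [h5]
  refine add_mem ?_ (Submodule.smul_mem _ _ h4)
  convert sub_mem h0 (add_mem h2 (add_mem h3 h1)) using 1
  rw [key]
  ring

/-- The bi-bracket `[b + 1; 1]` in terms of brackets. -/
lemma genSeries_P1_fst_mul (b : ℕ) :
    genSeries P1 (fun p => (p.1 : ℚ) * (p.2 : ℚ) ^ b) =
      genSeries D2 (fun p => (p.2.2.2 : ℚ) ^ b) -
      genSeries D2 (fun p => ((p.2.1 + p.2.2.2 : ℕ) : ℚ) ^ b) +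
      genSeries P1 (fun p => ∑ x ∈ Ioo 0 p.2, (x : ℚ) ^ b) +
      genSeries P1 (fun p => (p.2 : ℚ) ^ b) := by
  have h1 := genSeries_P2_shuffle (fun x => (x : ℚ) ^ b)
  rw [genSeries_P2 (fun p => (p.2.1 : ℚ) ^ b)] at h1
  have h2 : genSeries P1 (fun p => (p.1 : ℚ) * (p.2 : ℚ) ^ b) =
      genSeries P1 (fun p => ((p.1 : ℚ) - 1) * (p.2 : ℚ) ^ b) +
      genSeries P1 (fun p => (p.2 : ℚ) ^ b) := by
    rw [← map_add]
    refine congrArg _ (funext fun p => ?_)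
    simp
    ring
  rw [h2]
  linear_combination -h1

open Polynomial in
lemma genSeries_P2_eval_mem {K a : ℕ} {p : ℚ[X]} (h : p.natDegree + a + 2 ≤ K) :
    genSeries P2 (fun t => p.eval (t.2.1 : ℚ) * (t.2.2.2 : ℚ) ^ a) ∈ MD K := by
  have : (fun t : ℕ × ℕ × ℕ × ℕ => p.eval (t.2.1 : ℚ) * (t.2.2.2 : ℚ) ^ a) =
      ∑ m ∈ range (p.natDegree + 1), p.coeff m •
        fun t : ℕ × ℕ × ℕ × ℕ => (t.2.1 : ℚ) ^ m * (t.2.2.2 : ℚ) ^ a := by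
    ext t
    simp [eval_eq_sum_range, sum_mul, mul_assoc]
  rw [this, map_sum]
  refine Submodule.sum_mem _ fun m hm => ?_
  rw [mem_range] at hm
  rw [map_smul, genSeries_P2]
  refine Submodule.smul_mem _ _
    (add_mem (add_mem (genSeries_D2_monomial_mem (by omega)) ?_) ?_)
  · simp only [mul_comm (_ ^ m)]
    exact genSeries_D2_monomial_mem (by omega)
  · obtain ⟨q, hq, hq'⟩ := exists_polynomial_sum_pow_mul_pow m a
    convert genSeries_P1_eval_mem (p := q) (K := K) (by omega) using 1
    refine genSeries_congr fun n => ?_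
    rintro ⟨u, v⟩ h
    rw [mem_P1] at h
    exact hq' v h.2.1

open Polynomial in
lemma genSeries_P1_fst_mul_mul_mem (a b : ℕ) :
    genSeries P1 (fun p => (p.1 : ℚ) * (p.2 : ℚ) ^ b) * genSeries P1 (fun p => (p.2 : ℚ) ^ a) ∈
      MD (a + b + 3) := by
  rw [genSeries_P1_fst_mul, add_mul, add_mul, sub_mul]
  simp only [genSeries_D2_mul]
  refine add_mem (add_mem (sub_mem ?_ ?_) ?_) ?_
  · simpa using genSeries_D21_monomial_mem (i := 0) (j := b) (k := a) (K := a + b + 3) (by omega)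
  · exact genSeries_add_pow_mul_mem _ _ _ _ fun k l hkl => genSeries_D21_monomial_mem (by omega)
  · obtain ⟨q, hq, hq'⟩ := exists_polynomial_sum_pow b
    rw [genSeries_congr (g := fun p => q.eval (p.2 : ℚ)), genSeries_P1_mul]
    · exact genSeries_P2_eval_mem (by omega)
    · rintro n ⟨u, v⟩ h
      rw [mem_P1] at h
      exact hq' v h.2.1
  · rw [genSeries_P1_mul]
    simpa using genSeries_P2_eval_mem (p := (X ^ b : ℚ[X])) (a := a) (K := a + b + 3)
      (by simp; omega)

open Polynomial in
lemma genSeries_P1_fst_mul_eval_mem {K : ℕ} {p : ℚ[X]} (h : p.natDegree + 2 ≤ K) :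
    genSeries P1 (fun t => (t.1 : ℚ) * p.eval (t.2 : ℚ)) ∈ MD K := by
  have : (fun t : ℕ × ℕ => (t.1 : ℚ) * p.eval (t.2 : ℚ)) =
      ∑ m ∈ range (p.natDegree + 1), p.coeff m •
        fun t : ℕ × ℕ => (t.1 : ℚ) * (t.2 : ℚ) ^ m := by
    ext t
    simp only [eval_eq_sum_range, mul_sum, Finset.sum_apply, Pi.smul_apply, smul_eq_mul]
    exact sum_congr rfl fun m _ => by ring
  rw [this, map_sum]
  refine Submodule.sum_mem _ fun m hm => ?_
  rw [mem_range] at hm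
  rw [map_smul, genSeries_P1_fst_mul]
  refine Submodule.smul_mem _ _ (add_mem (add_mem (sub_mem ?_ ?_) ?_) ?_)
  · simpa using genSeries_D2_monomial_mem (i := 0) (j := m) (K := K) (by omega)
  · have := genSeries_add_pow_mul_mem (D := D2) (MD K) (fun p => p.2.1) (fun p => p.2.2.2)
      (fun _ => 0) (i := m) (j := 0) fun k l hkl => by
        simpa using genSeries_D2_monomial_mem (by omega)
    simpa using this
  · obtain ⟨q, hq, hq'⟩ := exists_polynomial_sum_pow m
    rw [genSeries_congr (g := fun p => q.eval (p.2 : ℚ))]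
    · exact genSeries_P1_eval_mem (by omega)
    · rintro n ⟨u, v⟩ h
      rw [mem_P1] at h
      exact hq' v h.2.1
  · exact genSeries_P1_monomial_mem (by omega)

/-- Up to a factorial factor, `[a + 1, b + 1; 0, 1]` is a combination of brackets. -/
lemma genSeries_D2_snd_mul_mem (a b : ℕ) :
    genSeries D2 (fun p => (p.2.2.1 : ℚ) * ((p.2.1 : ℚ) ^ a * (p.2.2.2 : ℚ) ^ b)) ∈
      MD (a + b + 3) := by
  have h1 := genSeries_P1_fst_mul_mul_mem a b
  rw [genSeries_P1_mul, genSeries_P2] at h1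
  have h2 := genSeries_D2_fst_mul_mem b a
  rw [add_comm b a] at h2
  have h3 : genSeries P1 (fun p => ∑ x ∈ Ioo 0 p.2,
      (p.1 : ℚ) * (x : ℚ) ^ b * ((p.2 - x : ℕ) : ℚ) ^ a) ∈ MD (a + b + 3) := by
    obtain ⟨q, hq, hq'⟩ := exists_polynomial_sum_pow_mul_pow b a
    convert genSeries_P1_fst_mul_eval_mem (p := q) (K := a + b + 3) (by omega) using 1
    refine genSeries_congr fun n => ?_
    rintro ⟨u, v⟩ h
    rw [mem_P1] at h
    simp only [← hq' v h.2.1, mul_sum, mul_assoc]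
  convert sub_mem (sub_mem h1 h2) h3 using 1
  simp only [mul_assoc, mul_comm (_ ^ b)]
  ring

end BiBracket

open BiBracket

/-- `[s₁,s₂; 1,0]` and `[s₁,s₂; 0,1]` lie in the ℚ-span of `1` and the brackets of
length at most `3` and weight at most `s₁ + s₂ + 1`. -/
theorem biBracket_length_two_in_MD (s₁ s₂ : ℕ) (h₁ : 1 ≤ s₁) (h₂ : 1 ≤ s₂) :
    biBracket 2 ![s₁, s₂] ![1, 0] ∈
      Submodule.span ℚ ({(1 : PowerSeries ℚ)} ∪
        {f | ∃ (m : ℕ) (t : Fin m → ℕ), 1 ≤ m ∧ m ≤ 3 ∧ (∀ j, 1 ≤ t j) ∧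
          (∑ j, t j) ≤ s₁ + s₂ + 1 ∧ f = biBracket m t fun _ => 0}) ∧
    biBracket 2 ![s₁, s₂] ![0, 1] ∈
      Submodule.span ℚ ({(1 : PowerSeries ℚ)} ∪
        {f | ∃ (m : ℕ) (t : Fin m → ℕ), 1 ≤ m ∧ m ≤ 3 ∧ (∀ j, 1 ≤ t j) ∧
          (∑ j, t j) ≤ s₁ + s₂ + 1 ∧ f = biBracket m t fun _ => 0}) := by
  change _ ∈ MD _ ∧ _ ∈ MD _
  constructor
  · have h := genSeries_D2_fst_mul_mem (s₁ - 1) (s₂ - 1)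
    rw [show s₁ - 1 + (s₂ - 1) + 3 = s₁ + s₂ + 1 by omega] at h
    convert Submodule.smul_mem _ (((s₁ - 1)! : ℚ) * (s₂ - 1)!)⁻¹ h using 1
    rw [biBracket_two, ← map_smul]
    refine congrArg _ (funext fun p => ?_)
    simp
    field_simp
  · have h := genSeries_D2_snd_mul_mem (s₁ - 1) (s₂ - 1)
    rw [show s₁ - 1 + (s₂ - 1) + 3 = s₁ + s₂ + 1 by omega] at h
    convert Submodule.smul_mem _ (((s₁ - 1)! : ℚ) * (s₂ - 1)!)⁻¹ h using 1
    rw [biBracket_two, ← map_smul]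
    refine congrArg _ (funext fun p => ?_)
    simp
    field_simp
end

section
/- (Stuffle-multiplicativity of truncated nested sums.) Let A be a commutative ℚ-algebra. Identify words with finite lists of positive integers and let ⋆ denote the stuffle product, the ℚ-bilinear product on the free ℚ-module on words determined by: the empty word is a two-sided unit, and (a::w) ⋆ (b::v) = a::(w ⋆ (b::v)) + b::((a::w) ⋆ v) + (a+b)::(w ⋆ v) for letters a, b and words w, v. Suppose for each m ∈ ℕ we are given a map f_m from words to A whose ℚ-linear extension satisfies f_m(empty) = 1 and f_m(u ⋆ v) = f_m(u)·f_m(v) for all words u, v. For a word w of length ℓ(w) ≥ 1 and M ∈ ℕ define F_w(M) := Σ_{k=1}^{ℓ(w)} Σ_{w = w₁w₂⋯w_k} Σ_{0 < m₁ < m₂ < … < m_k < M} f_{m₁}(w₁)·f_{m₂}(w₂)⋯f_{m_k}(w_k), where the middle sum is over all decompositions of the list w as a concatenation of k nonempty lists, and set F_{empty}(M) := 1. Then for every M ∈ ℕ the ℚ-linear extension of w ↦ F_w(M) is multiplicative for the stuffle product: F_{u ⋆ v}(M) = F_u(M)·F_v(M) for all words u, v. -/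
open scoped Nat

/-- The stuffle product of two words (lists of positive integers), with values in the
free ℚ-module on words: the empty word is a two-sided unit and
`(a::w) ⋆ (b::v) = a::(w ⋆ (b::v)) + b::((a::w) ⋆ v) + (a+b)::(w ⋆ v)`. -/
noncomputable def stuffle : List ℕ+ → List ℕ+ → (List ℕ+ →₀ ℚ)
  | [], v => Finsupp.single v 1
  | a :: w, [] => Finsupp.single (a :: w) 1
  | a :: w, b :: v =>
      (stuffle w (b :: v)).mapDomain (a :: ·) +
        (stuffle (a :: w) v).mapDomain (b :: ·) +
        (stuffle w v).mapDomain ((a + b) :: ·)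
  termination_by u v => u.length + v.length

/-- The truncated nested sum
`F_w(M) = ∑_{k} ∑_{w = w₁⋯w_k} ∑_{0 < m₁ < … < m_k < M} f_{m₁}(w₁)⋯f_{m_k}(w_k)`,
summed over all decompositions of `w` into nonempty words; `F_[](M) = 1`. -/
noncomputable def Fnested {A : Type*} [CommRing A] [Algebra ℚ A]
    (f : ℕ → List ℕ+ → A) (w : List ℕ+) (M : ℕ) : A :=
  ∑ᶠ pm ∈ {pm : List (List ℕ+) × List ℕ |
      pm.1.flatten = w ∧ (∀ p ∈ pm.1, p ≠ []) ∧ pm.2.length = pm.1.length ∧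
        pm.2.Chain' (· < ·) ∧ ∀ x ∈ pm.2, 0 < x ∧ x < M},
    ((pm.1.zip pm.2).map fun p => f p.2 p.1).prod

/-- The sum of `F x y` over all factorizations `w = x ++ y`. -/
def splitSum {α A : Type*} [AddCommMonoid A] (F : List α → List α → A) (w : List α) : A :=
  ∑ i ∈ Finset.range (w.length + 1), F (w.take i) (w.drop i)

section splitSum

variable {α A : Type*}

@[simp]
theorem splitSum_nil [AddCommMonoid A] (F : List α → List α → A) :
    splitSum F [] = F [] [] := by
  simp [splitSum]

theorem splitSum_cons [AddCommMonoid A] (F : List α → List α → A) (a : α) (w : List α) :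
    splitSum F (a :: w) = F [] (a :: w) + splitSum (fun x y => F (a :: x) y) w := by
  rw [splitSum, List.length_cons, Finset.sum_range_succ', add_comm]
  simp [splitSum]

theorem splitSum_add [AddCommMonoid A] (F G : List α → List α → A) (w : List α) :
    splitSum (fun x y => F x y + G x y) w = splitSum F w + splitSum G w :=
  Finset.sum_add_distrib

theorem splitSum_mul_splitSum [CommRing A] (F G : List α → List α → A) (u v : List α) :
    splitSum F u * splitSum G v =
      splitSum (fun x y => splitSum (fun x' y' => F x y * G x' y') v) u := by
  simp only [splitSum, Finset.sum_mul_sum]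

end splitSum

section stuffle

variable {A : Type*} [CommRing A] [Algebra ℚ A]

/-- The value on `stuffle u v` of the ℚ-linear extension of `g`. -/
noncomputable def stuffleEval (g : List ℕ+ → A) (u v : List ℕ+) : A :=
  Finsupp.linearCombination ℚ g (stuffle u v)

@[simp]
theorem stuffleEval_nil_left (g : List ℕ+ → A) (v : List ℕ+) : stuffleEval g [] v = g v := by
  simp [stuffleEval, stuffle]

@[simp]
theorem stuffleEval_nil_right (g : List ℕ+ → A) (u : List ℕ+) : stuffleEval g u [] = g u := by
  cases u <;> simp [stuffleEval, stuffle]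

theorem stuffleEval_cons_cons (g : List ℕ+ → A) (a b : ℕ+) (w v : List ℕ+) :
    stuffleEval g (a :: w) (b :: v) =
      stuffleEval (fun x => g (a :: x)) w (b :: v) +
        stuffleEval (fun x => g (b :: x)) (a :: w) v +
        stuffleEval (fun x => g ((a + b) :: x)) w v := by
  simp only [stuffleEval]
  rw [stuffle]
  simp only [map_add, Finsupp.linearCombination_mapDomain]
  rfl

theorem stuffleEval_add (g h : List ℕ+ → A) (u v : List ℕ+) :
    stuffleEval (fun w => g w + h w) u v = stuffleEval g u v + stuffleEval h u v := by
  simp [stuffleEval, Finsupp.linearCombination_apply, Finsupp.sum, Finset.sum_add_distrib]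

theorem stuffleEval_const_mul (c : A) (g : List ℕ+ → A) (u v : List ℕ+) :
    stuffleEval (fun w => c * g w) u v = c * stuffleEval g u v := by
  simp [stuffleEval, Finsupp.linearCombination_apply, Finsupp.sum, Finset.mul_sum]

/-- Deconcatenation is compatible with the stuffle product. -/
theorem stuffleEval_splitSum (g h : List ℕ+ → A) (u v : List ℕ+) :
    stuffleEval (splitSum fun x y => g x * h y) u v =
      splitSum (fun x y =>
        splitSum (fun x' y' => stuffleEval g x x' * stuffleEval h y y') v) u := by
  match u, v with
  | [], v => simp
  | a :: w, [] => simp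
  | a :: w, b :: v =>
    rw [stuffleEval_cons_cons]
    simp only [splitSum_cons, stuffleEval_add, stuffleEval_const_mul]
    rw [stuffleEval_splitSum (fun x => g (a :: x)) h w (b :: v),
      stuffleEval_splitSum (fun x => g (b :: x)) h (a :: w) v,
      stuffleEval_splitSum (fun x => g ((a + b) :: x)) h w v]
    simp only [splitSum_cons, splitSum_add, stuffleEval_cons_cons, stuffleEval_nil_left,
      stuffleEval_nil_right, add_mul, mul_add]
    ring
  termination_by u.length + v.length

theorem stuffleEval_splitSum_of_mul {g h : List ℕ+ → A}
    (hg : ∀ u v, stuffleEval g u v = g u * g v) (hh : ∀ u v, stuffleEval h u v = h u * h v)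
    (u v : List ℕ+) :
    stuffleEval (splitSum fun x y => g x * h y) u v =
      splitSum (fun x y => g x * h y) u * splitSum (fun x y => g x * h y) v := by
  rw [stuffleEval_splitSum, splitSum_mul_splitSum]
  simp only [hg, hh, mul_mul_mul_comm]

theorem stuffleEval_ite_nil (u v : List ℕ+) :
    stuffleEval (fun w => if w = [] then (1 : A) else 0) u v =
      (if u = [] then 1 else 0) * (if v = [] then 1 else 0) := by
  match u, v with
  | [], v => simp
  | a :: w, [] => simp
  | a :: w, b :: v =>
    rw [stuffleEval_cons_cons]
    simp [stuffleEval, Finsupp.linearCombination_apply]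

end stuffle

section Fnested

/-- The index set of `Fnested f w M`. -/
def nestedIndex (w : List ℕ+) (M : ℕ) : Set (List (List ℕ+) × List ℕ) :=
  {pm | pm.1.flatten = w ∧ (∀ p ∈ pm.1, p ≠ []) ∧ pm.2.length = pm.1.length ∧
    pm.2.IsChain (· < ·) ∧ ∀ x ∈ pm.2, 0 < x ∧ x < M}

/-- Append a last block together with its summation index. -/
def snocBlock (p : List ℕ+) (m : ℕ) (pm : List (List ℕ+) × List ℕ) :
    List (List ℕ+) × List ℕ :=
  (pm.1 ++ [p], pm.2 ++ [m])

theorem snocBlock_injective (p : List ℕ+) (m : ℕ) : Function.Injective (snocBlock p m) := by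
  rintro ⟨a, b⟩ ⟨c, d⟩ h
  simpa [snocBlock] using h

theorem nestedIndex_zero (w : List ℕ+) :
    nestedIndex w 0 = if w = [] then {([], [])} else ∅ := by
  ext ⟨ps, ms⟩
  cases ms with
  | nil =>
    cases ps with
    | nil => split_ifs with h <;> simp [nestedIndex, h, eq_comm]
    | cons p ps => split_ifs <;> simp [nestedIndex]
  | cons m ms =>
    have h : (ps, m :: ms) ∉ nestedIndex w 0 := fun h =>
      Nat.not_lt_zero m (h.2.2.2.2 m List.mem_cons_self).2
    split_ifs <;> simp [h]

theorem nestedIndex_one (w : List ℕ+) : nestedIndex w 1 = nestedIndex w 0 := by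
  ext ⟨ps, ms⟩
  cases ms with
  | nil => simp [nestedIndex]
  | cons m ms =>
    simp only [nestedIndex, Set.mem_ofPred_eq, List.forall_mem_cons]
    omega

theorem snocBlock_mem_nestedIndex {w p : List ℕ+} {M : ℕ} (hM : 0 < M) (hp : p ≠ [])
    {pm : List (List ℕ+) × List ℕ} (h : pm ∈ nestedIndex w M) :
    snocBlock p M pm ∈ nestedIndex (w ++ p) (M + 1) := by
  obtain ⟨h1, h2, h3, h4, h5⟩ := h
  refine ⟨by simp [snocBlock, h1], ?_, by simp [snocBlock, h3], ?_, ?_⟩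
  · simp only [snocBlock, List.mem_append, List.mem_singleton]
    rintro q (hq | rfl)
    exacts [h2 q hq, hp]
  · rw [List.isChain_iff_pairwise] at h4 ⊢
    simp only [snocBlock, List.pairwise_append, List.pairwise_singleton, List.mem_singleton,
      true_and]
    refine ⟨h4, ?_⟩
    rintro x hx _ rfl
    exact (h5 x hx).2
  · simp only [snocBlock, List.mem_append, List.mem_singleton]
    rintro x (hx | rfl)
    · have := h5 x hx
      omega
    · omega

theorem nestedIndex_succ (w : List ℕ+) {M : ℕ} (hM : 0 < M) :
    nestedIndex w (M + 1) = (⋃ i ∈ (Finset.range w.length : Set ℕ),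
      snocBlock (w.drop i) M '' nestedIndex (w.take i) M) ∪ nestedIndex w M := by
  ext ⟨ps, ms⟩
  simp only [Set.mem_union, Set.mem_iUnion, Finset.mem_coe, Finset.mem_range, Set.mem_image]
  constructor
  · rintro ⟨h1, h2, h3, h4, h5⟩
    dsimp only at h1 h2 h3 h4 h5
    rcases List.eq_nil_or_concat' ms with rfl | ⟨ms, m, rfl⟩
    · exact Or.inr ⟨h1, h2, h3, h4, by simp⟩
    rcases List.eq_nil_or_concat' ps with rfl | ⟨ps, p, rfl⟩
    · simp at h3
    have h4' := h4
    rw [List.isChain_iff_pairwise, List.pairwise_append] at h4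
    obtain ⟨h6, -, h7⟩ := h4
    have hm := h5 m (by simp)
    have hlt : ∀ x ∈ ms, x < m := fun x hx => h7 x hx m (by simp)
    rcases Nat.lt_succ_iff_lt_or_eq.1 hm.2 with hmM | rfl
    · refine Or.inr ⟨h1, h2, h3, h4', fun x hx => ⟨(h5 x hx).1, ?_⟩⟩
      rcases List.mem_append.1 hx with hx | hx
      · exact (hlt x hx).trans hmM
      · rwa [List.mem_singleton.1 hx]
    · left
      have hp : p ≠ [] := h2 p (by simp)
      have hw : w = ps.flatten ++ p := by simpa using h1.symm
      refine ⟨ps.flatten.length, ?_, (ps, ms), ⟨?_, ?_, ?_, ?_, ?_⟩, ?_⟩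
      · rw [hw, List.length_append]
        have := List.length_pos_iff.2 hp
        omega
      · simp only [hw, List.take_left']
      · exact fun q hq => h2 q (by simp [hq])
      · simpa using h3
      · exact List.isChain_iff_pairwise.2 h6
      · exact fun x hx => ⟨(h5 x (by simp [hx])).1, hlt x hx⟩
      · simp only [snocBlock, hw, List.drop_left']
  · rintro (⟨i, hi, pm, hpm, h⟩ | ⟨h1, h2, h3, h4, h5⟩)
    · have := snocBlock_mem_nestedIndex hM (p := w.drop i) (by simpa using hi) hpm
      rwa [h, List.take_append_drop] at this
    · exact ⟨h1, h2, h3, h4, fun x hx => ⟨(h5 x hx).1, (h5 x hx).2.trans (Nat.lt_succ_self M)⟩⟩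

theorem finite_nestedIndex (w : List ℕ+) (M : ℕ) : (nestedIndex w M).Finite := by
  induction M generalizing w with
  | zero =>
    rw [nestedIndex_zero]
    split_ifs <;> simp
  | succ M ih =>
    rcases Nat.eq_zero_or_pos M with rfl | hM
    · rw [nestedIndex_one]
      exact ih w
    · rw [nestedIndex_succ w hM]
      exact ((Finset.range w.length).finite_toSet.biUnion
        fun i _ => (ih _).image _).union (ih w)

variable {A : Type*} [CommRing A] [Algebra ℚ A]

theorem Fnested_eq (f : ℕ → List ℕ+ → A) (w : List ℕ+) (M : ℕ) :
    Fnested f w M =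
      ∑ᶠ pm ∈ nestedIndex w M, ((pm.1.zip pm.2).map fun p => f p.2 p.1).prod :=
  rfl

theorem Fnested_zero (f : ℕ → List ℕ+ → A) (w : List ℕ+) :
    Fnested f w 0 = if w = [] then 1 else 0 := by
  rw [Fnested_eq, nestedIndex_zero]
  split_ifs
  · rw [finsum_mem_singleton]
    simp
  · exact finsum_mem_empty

theorem Fnested_one (f : ℕ → List ℕ+ → A) (w : List ℕ+) : Fnested f w 1 = Fnested f w 0 := by
  rw [Fnested_eq, nestedIndex_one, ← Fnested_eq]

theorem Fnested_succ {f : ℕ → List ℕ+ → A} {M : ℕ} (hf : f M [] = 1) (hM : 0 < M)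
    (w : List ℕ+) :
    Fnested f w (M + 1) = splitSum (fun x y => Fnested f x M * f M y) w := by
  rw [Fnested_eq, nestedIndex_succ w hM, finsum_mem_union, finsum_mem_biUnion, splitSum,
    Finset.sum_range_succ, ← finsum_mem_coe_finset]
  · simp only [List.take_length, List.drop_length, hf, mul_one, ← Fnested_eq]
    congr 1
    refine finsum_mem_congr rfl fun i _ => ?_
    rw [finsum_mem_image (snocBlock_injective _ _).injOn, Fnested_eq,
      finsum_mem_mul' _ _ (finite_nestedIndex _ _)]
    refine finsum_mem_congr rfl fun pm hpm => ?_
    rw [snocBlock, List.zip_append hpm.2.2.1.symm]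
    simp
  · intro i hi j hj hij
    rw [Function.onFun, Set.disjoint_left]
    rintro _ ⟨pm, -, rfl⟩ ⟨qm, -, h⟩
    simp only [snocBlock, Prod.mk.injEq, List.append_left_inj] at h
    have h' := congrArg List.length (List.singleton_inj.1 (List.append_inj_right' h.1 rfl))
    simp only [Finset.coe_range, Set.mem_Iio, List.length_drop] at hi hj h'
    omega
  · exact Finset.finite_toSet _
  · exact fun i _ => (finite_nestedIndex _ _).image _
  · rw [Set.disjoint_left]
    intro x hx hx'
    simp only [Set.mem_iUnion] at hx
    obtain ⟨i, -, pm, -, rfl⟩ := hx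
    exact lt_irrefl M (hx'.2.2.2.2 M (by simp [snocBlock])).2
  · exact (Finset.range w.length).finite_toSet.biUnion
      fun i _ => (finite_nestedIndex _ _).image _
  · exact finite_nestedIndex _ _

end Fnested

/-- Stuffle-multiplicativity of truncated nested sums: if each `f_m` is (after ℚ-linear
extension) multiplicative for the stuffle product and sends the empty word to `1`,
then so is `w ↦ F_w(M)` for every `M`. -/
theorem Fnested_stuffle_mul {A : Type*} [CommRing A] [Algebra ℚ A]
    (f : ℕ → List ℕ+ → A)
    (hf1 : ∀ m, f m [] = 1)
    (hfmul : ∀ m u v, ((stuffle u v).sum fun w c => c • f m w) = f m u * f m v)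
    (M : ℕ) (u v : List ℕ+) :
    ((stuffle u v).sum fun w c => c • Fnested f w M) =
      Fnested f u M * Fnested f v M := by
  change stuffleEval (fun w => Fnested f w M) u v = _
  induction M generalizing u v with
  | zero =>
    simp only [Fnested_zero]
    exact stuffleEval_ite_nil u v
  | succ M ih =>
    rcases Nat.eq_zero_or_pos M with rfl | hM
    · simp only [zero_add, Fnested_one]
      exact ih u v
    · simp only [Fnested_succ (hf1 M) hM]
      exact stuffleEval_splitSum_of_mul ih (hfmul M) u v
end

section
/- (Bi-brackets as q-analogues of multiple zeta values.) Let l ≥ 1 and let s₁,…,sₗ ≥ 1, r₁,…,rₗ ≥ 0 be integers with s₁ ≥ r₁ + 2 and s_j ≥ r_j + 1 for 2 ≤ j ≤ l. For real q with 0 < q < 1 the series b(q) := Σ ∏_{j=1}^{l} (u_j^{r_j}/r_j!)·(v_j^{s_j−1}/(s_j−1)!)·q^{u₁v₁+…+uₗvₗ}, summed over all integer tuples u₁ > … > uₗ > 0 and v₁,…,vₗ > 0, converges, and lim_{q→1⁻} (1−q)^{s₁+…+sₗ} · b(q) = (1/(r₁!·r₂!⋯rₗ!)) · Σ_{n₁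 > n₂ > … > nₗ > 0} ∏_{j=1}^{l} n_j^{−(s_j−r_j)}, where the right-hand side is the (convergent) multiple zeta value ζ(s₁−r₁, …, sₗ−rₗ) divided by r₁!⋯rₗ!. -/
open scoped Nat

/-- Index set for the defining series of a bi-bracket: pairs `(u,v)` of `l`-tuples of
positive integers with `u₁ > … > uₗ > 0`. -/
def biIdx (l : ℕ) : Set ((Fin l → ℕ) × (Fin l → ℕ)) :=
  {uv | StrictAnti uv.1 ∧ (∀ j, 0 < uv.1 j) ∧ (∀ j, 0 < uv.2 j)}

/-- The general term of the bi-bracket series evaluated at a real `q`. -/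
noncomputable def biTerm (l : ℕ) (s r : Fin l → ℕ) (q : ℝ)
    (uv : (Fin l → ℕ) × (Fin l → ℕ)) : ℝ :=
  (∏ j, ((uv.1 j : ℝ) ^ r j / (r j)!) * ((uv.2 j : ℝ) ^ (s j - 1) / ((s j - 1)!))) *
    q ^ (∑ j, uv.1 j * uv.2 j)

theorem hasSum_pi_prod_of_nonneg {n : ℕ} (f : Fin n → ℕ → ℝ) (a : Fin n → ℝ)
    (hf : ∀ j m, 0 ≤ f j m) (h : ∀ j, HasSum (f j) (a j)) :
    HasSum (fun v : Fin n → ℕ => ∏ j, f j (v j)) (∏ j, a j) := by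
  induction n with
  | zero => simp
  | succ n ih =>
    have ht := ih (fun j => f j.succ) (fun j => a j.succ) (fun j => hf j.succ) fun j => h j.succ
    have hs := (h 0).summable.mul_of_nonneg ht.summable (fun m => hf 0 m)
      fun v => Finset.prod_nonneg fun j _ => hf _ _
    rw [← (Fin.consEquiv fun _ : Fin (n + 1) => ℕ).hasSum_iff]
    simpa [Function.comp_def, Fin.consEquiv, Fin.prod_univ_succ] using (h 0).mul ht hs

/-- The normalized power series `∑_{v ≥ 1} v ^ k / k! * x ^ v`. -/
noncomputable def powGeomSum (k : ℕ) (x : ℝ) : ℝ :=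
  ∑' n : ℕ, ((n + 1 : ℕ) : ℝ) ^ k / k ! * x ^ (n + 1)

section powGeomSum

variable {x : ℝ} (k : ℕ)

theorem pow_div_factorial_mul_le (hx0 : 0 ≤ x) (n : ℕ) :
    ((n + 1 : ℕ) : ℝ) ^ k / k ! * x ^ (n + 1) ≤ x * ((n + k).choose k * x ^ n) := by
  have h := Nat.pow_le_choose (α := ℝ) k (n + k)
  rw [show n + k + 1 - k = n + 1 by omega] at h
  calc _ ≤ ((n + k).choose k : ℝ) * x ^ (n + 1) := by gcongr
    _ = _ := by ring

theorem summable_powGeomSum (hx0 : 0 ≤ x) (hx1 : x < 1) :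
    Summable fun n : ℕ => ((n + 1 : ℕ) : ℝ) ^ k / k ! * x ^ (n + 1) :=
  .of_nonneg_of_le (fun _ => by positivity) (pow_div_factorial_mul_le k hx0)
    ((summable_choose_mul_geometric_of_norm_lt_one k
      (by rwa [Real.norm_of_nonneg hx0])).mul_left x)

theorem powGeomSum_nonneg (hx0 : 0 ≤ x) : 0 ≤ powGeomSum k x :=
  tsum_nonneg fun _ => by positivity

theorem powGeomSum_le (hx0 : 0 ≤ x) (hx1 : x < 1) :
    powGeomSum k x ≤ x / (1 - x) ^ (k + 1) := by
  have h := (hasSum_choose_mul_geometric_of_norm_lt_one (𝕜 := ℝ) k (r := x)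
    (by rwa [Real.norm_of_nonneg hx0])).mul_left x
  rw [mul_one_div] at h
  exact hasSum_le (pow_div_factorial_mul_le k hx0) (summable_powGeomSum k hx0 hx1).hasSum h

theorem le_powGeomSum (hx0 : 0 ≤ x) (hx1 : x < 1) :
    (x / (1 - x)) ^ (k + 1) ≤ powGeomSum k x := by
  have h := (hasSum_choose_mul_geometric_of_norm_lt_one (𝕜 := ℝ) k (r := x)
    (by rwa [Real.norm_of_nonneg hx0])).mul_left (x ^ (k + 1))
  rw [mul_one_div, ← div_pow] at h
  have hs := summable_powGeomSum k hx0 hx1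
  refine (hasSum_le (fun n => ?_) h (hs.comp_injective (add_left_injective k)).hasSum).trans
    (tsum_comp_le_tsum_of_inj hs (fun _ => by positivity) (add_left_injective k))
  have hc := Nat.choose_le_pow_div (α := ℝ) k (n + k)
  have hp : ((n + k : ℕ) : ℝ) ^ k / k ! ≤ ((n + k + 1 : ℕ) : ℝ) ^ k / k ! := by
    gcongr ?_ ^ k / _
    exact_mod_cast Nat.le_succ _
  calc x ^ (k + 1) * ((n + k).choose k * x ^ n)
      = ((n + k).choose k : ℝ) * x ^ (n + k + 1) := by ring
    _ ≤ ((n + k + 1 : ℕ) : ℝ) ^ k / k ! * x ^ (n + k + 1) := by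
      gcongr; exact_mod_cast hc.trans hp

end powGeomSum

theorem one_sub_pow_mul_powGeomSum_le (k : ℕ) {u : ℕ} (hu : 0 < u) {q : ℝ}
    (hq : q ∈ Set.Ioo (0 : ℝ) 1) :
    (1 - q) ^ (k + 1) * powGeomSum k (q ^ u) ≤
      (k + 1)! * Real.exp 1 * ((u : ℝ) ^ (k + 1))⁻¹ := by
  obtain ⟨hq0, hq1⟩ := hq
  have hx0 : 0 < q ^ u := by positivity
  have hx1 : q ^ u < 1 := pow_lt_one₀ hq0.le hq1 hu.ne'
  have hu' : (0 : ℝ) < u := by exact_mod_cast hu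
  have hd : 0 < 1 - q := sub_pos.2 hq1
  have hdx : 0 < 1 - q ^ u := sub_pos.2 hx1
  set T : ℝ := u * (1 - q) with hT
  have hT0 : 0 < T := by positivity
  have hexp : q ^ u ≤ Real.exp (-T) := by
    have h : q ≤ Real.exp (-(1 - q)) := by linarith [Real.add_one_le_exp (-(1 - q))]
    calc q ^ u ≤ Real.exp (-(1 - q)) ^ u := by gcongr
      _ = _ := by rw [← Real.exp_nat_mul]; congr 1; rw [hT]; ring
  have hbern : q ^ u * (1 + T) ≤ 1 := by
    have h := Real.add_one_le_exp T
    calc q ^ u * (1 + T) ≤ Real.exp (-T) * Real.exp T := by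
          gcongr; linarith
      _ = 1 := by rw [← Real.exp_add]; simp
  have hquot : (1 - q) / (1 - q ^ u) ≤ (1 + T) / u := by
    rw [div_le_div_iff₀ hdx hu']
    nlinarith
  have hfac : (1 + T) ^ (k + 1) ≤ (k + 1)! * Real.exp (1 + T) := by
    have := Real.pow_div_factorial_le_exp (x := 1 + T) (by positivity) (k + 1)
    rwa [div_le_iff₀ (by positivity), mul_comm] at this
  calc (1 - q) ^ (k + 1) * powGeomSum k (q ^ u)
      ≤ (1 - q) ^ (k + 1) * (q ^ u / (1 - q ^ u) ^ (k + 1)) := by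
        gcongr; exact powGeomSum_le k hx0.le hx1
    _ = q ^ u * ((1 - q) / (1 - q ^ u)) ^ (k + 1) := by rw [div_pow]; ring
    _ ≤ Real.exp (-T) * ((1 + T) / u) ^ (k + 1) := by gcongr
    _ = Real.exp (-T) * (1 + T) ^ (k + 1) * ((u : ℝ) ^ (k + 1))⁻¹ := by rw [div_pow]; ring
    _ ≤ Real.exp (-T) * ((k + 1)! * Real.exp (1 + T)) * ((u : ℝ) ^ (k + 1))⁻¹ := by gcongr
    _ = (k + 1)! * (Real.exp (-T) * Real.exp (1 + T)) * ((u : ℝ) ^ (k + 1))⁻¹ := by ring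
    _ = _ := by rw [← Real.exp_add]; simp

theorem tendsto_one_sub_pow_mul_powGeomSum (k : ℕ) {u : ℕ} (hu : 0 < u) :
    Filter.Tendsto (fun q : ℝ => (1 - q) ^ (k + 1) * powGeomSum k (q ^ u))
      (nhdsWithin 1 (Set.Ioo (0 : ℝ) 1)) (nhds ((u : ℝ) ^ (k + 1))⁻¹) := by
  have hpow : Filter.Tendsto (fun q : ℝ => q ^ u) (nhdsWithin 1 (Set.Ioo (0 : ℝ) 1)) (nhds 1) := by
    have : ContinuousAt (fun q : ℝ => q ^ u) 1 := by fun_prop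
    simpa using this.tendsto.mono_left nhdsWithin_le_nhds
  have hgeom : Filter.Tendsto (fun q : ℝ => (1 - q) / (1 - q ^ u))
      (nhdsWithin 1 (Set.Ioo (0 : ℝ) 1)) (nhds (u : ℝ)⁻¹) := by
    have hc : ContinuousAt (fun q : ℝ => (∑ i ∈ Finset.range u, q ^ i)⁻¹) 1 :=
      ContinuousAt.inv₀ (by fun_prop) (by simp [hu.ne'])
    have hl := hc.tendsto.mono_left (nhdsWithin_le_nhds (s := Set.Ioo (0 : ℝ) 1))
    simp only [one_pow, Finset.sum_const, Finset.card_range, nsmul_eq_mul, mul_one] at hl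
    refine hl.congr' ?_
    filter_upwards [self_mem_nhdsWithin] with q hq
    have hd : 1 - q ≠ 0 := (sub_pos.2 hq.2).ne'
    rw [← mul_neg_geom_sum q u, div_mul_cancel_left₀ hd]
  have hlo := ((hpow.mul hgeom).pow (k + 1))
  have hhi := hpow.mul (hgeom.pow (k + 1))
  rw [one_mul, inv_pow] at hlo hhi
  refine tendsto_of_tendsto_of_tendsto_of_le_of_le' hlo hhi ?_ ?_ <;>
    filter_upwards [self_mem_nhdsWithin] with q hq
  all_goals
    have hx0 : 0 ≤ q ^ u := pow_nonneg hq.1.le u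
    have hx1 : q ^ u < 1 := pow_lt_one₀ hq.1.le hq.2 hu.ne'
    have hd : 0 ≤ (1 - q) ^ (k + 1) := pow_nonneg (sub_pos.2 hq.2).le _
  · refine le_of_eq_of_le ?_ (mul_le_mul_of_nonneg_left (le_powGeomSum k hx0 hx1) hd)
    rw [← mul_pow]; ring
  · refine (mul_le_mul_of_nonneg_left (powGeomSum_le k hx0 hx1) hd).trans_eq ?_
    rw [div_pow]; ring

/-- Convergence of the multiple zeta series. -/
theorem summable_multipleZeta {l : ℕ} (hl : 0 < l) (a : Fin l → ℕ) (h1 : 2 ≤ a ⟨0, hl⟩)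
    (ha : ∀ j, 1 ≤ a j) :
    Summable fun n : {n : Fin l → ℕ // StrictAnti n ∧ ∀ j, 0 < n j} =>
      ∏ j, ((n.1 j : ℝ) ^ a j)⁻¹ := by
  have hl' : (0 : ℝ) < l := by exact_mod_cast hl
  have hp : (1 : ℝ) < 1 + (l : ℝ)⁻¹ := by linarith [inv_pos.2 hl']
  have hs := (hasSum_pi_prod_of_nonneg (fun (_ : Fin l) (m : ℕ) => ((m : ℝ) ^ (1 + (l : ℝ)⁻¹))⁻¹)
    _ (fun _ _ => by positivity) fun _ => (Real.summable_nat_rpow_inv.2 hp).hasSum).summable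
  refine .of_nonneg_of_le (fun _ => by positivity) ?_ (hs.comp_injective Subtype.val_injective)
  rintro ⟨n, hn, hpos⟩
  simp only [Function.comp_apply, Finset.prod_inv_distrib]
  have hpos' : ∀ j, (1 : ℝ) ≤ n j := fun j => by exact_mod_cast hpos j
  have hpos0 : ∀ j, (0 : ℝ) < n j := fun j => by exact_mod_cast hpos j
  gcongr ?_⁻¹
  · exact Finset.prod_pos fun j _ => Real.rpow_pos_of_pos (hpos0 j) _
  set z : Fin l := ⟨0, hl⟩
  calc ∏ j, (n j : ℝ) ^ (1 + (l : ℝ)⁻¹)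
      = (∏ j, (n j : ℝ)) * ∏ j, (n j : ℝ) ^ (l : ℝ)⁻¹ := by
        rw [← Finset.prod_mul_distrib]
        exact Finset.prod_congr rfl fun j _ => by rw [Real.rpow_add (hpos0 j), Real.rpow_one]
    _ ≤ (∏ j, (n j : ℝ)) * ∏ _j : Fin l, (n z : ℝ) ^ (l : ℝ)⁻¹ := by
        gcongr with j
        exact hn.antitone (Fin.mk_le_of_le_val (Nat.zero_le _))
    _ = (∏ j, (n j : ℝ)) * n z := by
        rw [Finset.prod_const, Finset.card_univ, Fintype.card_fin,
          Real.rpow_inv_natCast_pow (hpos0 z).le hl.ne']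
    _ = ∏ j, (n j : ℝ) * if j = z then (n z : ℝ) else 1 := by
        rw [Finset.prod_mul_distrib, Finset.prod_ite_eq']; simp
    _ ≤ ∏ j, (n j : ℝ) ^ a j := by
        refine Finset.prod_le_prod (fun j _ => by positivity) fun j _ => ?_
        split_ifs with hj
        · subst hj
          rw [← sq]
          exact pow_le_pow_right₀ (hpos' _) h1
        · simpa using pow_le_pow_right₀ (hpos' j) (ha j)

/-- Splitting the index set of a bi-bracket, with the second tuple shifted down by one. -/
def biIdxEquiv (l : ℕ) :
    {n : Fin l → ℕ // StrictAnti n ∧ ∀ j, 0 < n j} × (Fin l → ℕ) ≃ biIdx l where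
  toFun p := ⟨(p.1.1, fun j => p.2 j + 1), p.1.2.1, p.1.2.2, fun _ => Nat.succ_pos _⟩
  invFun x := (⟨x.1.1, x.2.1, x.2.2.1⟩, fun j => x.1.2 j - 1)
  left_inv _ := rfl
  right_inv x := Subtype.ext <| Prod.ext rfl <| funext fun j => Nat.sub_add_cancel (x.2.2.2 j)

theorem biTerm_biIdxEquiv {l : ℕ} (s r : Fin l → ℕ) (q : ℝ)
    (u : {n : Fin l → ℕ // StrictAnti n ∧ ∀ j, 0 < n j}) (w : Fin l → ℕ) :
    biTerm l s r q (biIdxEquiv l (u, w)) =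
      ∏ j, (u.1 j : ℝ) ^ r j / (r j)! *
        (((w j + 1 : ℕ) : ℝ) ^ (s j - 1) / (s j - 1)! * (q ^ u.1 j) ^ (w j + 1)) := by
  simp only [biTerm, biIdxEquiv, Equiv.coe_fn_mk, ← Finset.prod_pow_eq_pow_sum,
    ← Finset.prod_mul_distrib, pow_mul, mul_assoc]

theorem hasSum_biTerm_fiber {l : ℕ} (s r : Fin l → ℕ) {q : ℝ} (hq : q ∈ Set.Ioo (0 : ℝ) 1)
    (u : {n : Fin l → ℕ // StrictAnti n ∧ ∀ j, 0 < n j}) :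
    HasSum (fun w : Fin l → ℕ => biTerm l s r q (biIdxEquiv l (u, w)))
      (∏ j, (u.1 j : ℝ) ^ r j / (r j)! * powGeomSum (s j - 1) (q ^ u.1 j)) := by
  have hx0 := hq.1.le
  simp only [biTerm_biIdxEquiv]
  exact hasSum_pi_prod_of_nonneg
    (fun j m => (u.1 j : ℝ) ^ r j / (r j)! *
      (((m + 1 : ℕ) : ℝ) ^ (s j - 1) / (s j - 1)! * (q ^ u.1 j) ^ (m + 1))) _
    (fun _ _ => by positivity) fun j =>
      (summable_powGeomSum _ (by positivity)
        (pow_lt_one₀ hx0 hq.2 (u.2.2 j).ne')).hasSum.mul_left _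

theorem pow_div_mul_inv_pow {m r s : ℕ} (hm : 0 < m) (h : r ≤ s) (c : ℝ) :
    (m : ℝ) ^ r / r ! * (c * ((m : ℝ) ^ s)⁻¹) = c / r ! * ((m : ℝ) ^ (s - r))⁻¹ := by
  have hm' : (m : ℝ) ≠ 0 := by exact_mod_cast hm.ne'
  obtain ⟨d, rfl⟩ := Nat.exists_eq_add_of_le h
  rw [Nat.add_sub_cancel_left, pow_add]
  field_simp

/-- Bi-brackets as q-analogues of multiple zeta values: for `s₁ ≥ r₁+2` and
`sⱼ ≥ rⱼ+1`, the series `b(q)` converges for `0 < q < 1` and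
`lim_{q→1⁻} (1−q)^{s₁+…+sₗ} b(q) = ζ(s₁−r₁,…,sₗ−rₗ)/(r₁!⋯rₗ!)`. -/
theorem biBracket_qAnalogue (l : ℕ) (hl : 0 < l) (s r : Fin l → ℕ)
    (h1 : r ⟨0, hl⟩ + 2 ≤ s ⟨0, hl⟩) (hall : ∀ j, r j + 1 ≤ s j) :
    (∀ q ∈ Set.Ioo (0 : ℝ) 1, Summable fun uv : biIdx l => biTerm l s r q uv) ∧
      Filter.Tendsto
        (fun q : ℝ => (1 - q) ^ (∑ j, s j) * ∑' uv : biIdx l, biTerm l s r q uv)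
        (nhdsWithin 1 (Set.Ioo (0 : ℝ) 1))
        (nhds ((∏ j, ((r j)! : ℝ))⁻¹ *
          ∑' n : {n : Fin l → ℕ // StrictAnti n ∧ ∀ j, 0 < n j},
            ∏ j, ((n.1 j : ℝ) ^ (s j - r j))⁻¹)) := by
  let U := {n : Fin l → ℕ // StrictAnti n ∧ ∀ j, 0 < n j}
  let F : ℝ → U → ℝ := fun q u =>
    ∏ j, (u.1 j : ℝ) ^ r j / (r j)! * powGeomSum (s j - 1) (q ^ u.1 j)
  have hs : ∀ j, s j - 1 + 1 = s j := fun j => by have := hall j; omega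
  have hscale : ∀ q u, (1 - q) ^ (∑ j, s j) * F q u =
      ∏ j, (u.1 j : ℝ) ^ r j / (r j)! *
        ((1 - q) ^ s j * powGeomSum (s j - 1) (q ^ u.1 j)) := fun q u => by
    simp only [F, ← Finset.prod_pow_eq_pow_sum, ← Finset.prod_mul_distrib]
    exact Finset.prod_congr rfl fun j _ => by ring
  have hmzv : Summable fun n : U => ∏ j, ((n.1 j : ℝ) ^ (s j - r j))⁻¹ :=
    summable_multipleZeta hl _ (by omega) fun j => by have := hall j; omega
  have hnonneg : ∀ q ∈ Set.Ioo (0 : ℝ) 1, ∀ u, 0 ≤ (1 - q) ^ (∑ j, s j) * F q u := by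
    intro q hq u
    have hd := sub_pos.2 hq.2
    have hx0 := hq.1.le
    exact mul_nonneg (by positivity) <| Finset.prod_nonneg fun j _ =>
      mul_nonneg (by positivity) (powGeomSum_nonneg _ (by positivity))
  have hbound : ∀ q ∈ Set.Ioo (0 : ℝ) 1, ∀ u : U, (1 - q) ^ (∑ j, s j) * F q u ≤
      (∏ j, ((s j)! * Real.exp 1) / (r j)!) * ∏ j, ((u.1 j : ℝ) ^ (s j - r j))⁻¹ := by
    intro q hq u
    have hd := sub_pos.2 hq.2
    have hx0 := hq.1.le
    rw [hscale, ← Finset.prod_mul_distrib]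
    refine Finset.prod_le_prod (fun j _ => mul_nonneg (by positivity)
      (mul_nonneg (by positivity) (powGeomSum_nonneg _ (by positivity)))) fun j _ => ?_
    rw [← pow_div_mul_inv_pow (u.2.2 j) (Nat.le_of_succ_le (hall j))]
    have h := one_sub_pow_mul_powGeomSum_le (s j - 1) (u.2.2 j) hq
    rw [hs] at h
    gcongr
  have hsumF : ∀ q ∈ Set.Ioo (0 : ℝ) 1, Summable (F q) := fun q hq =>
    (summable_mul_left_iff (pow_ne_zero _ (sub_pos.2 hq.2).ne')).1 <|
      .of_nonneg_of_le (hnonneg q hq) (hbound q hq) (hmzv.mul_left _)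
  have hsum : ∀ q ∈ Set.Ioo (0 : ℝ) 1,
      Summable fun p : U × (Fin l → ℕ) => biTerm l s r q (biIdxEquiv l p) := by
    intro q hq
    have hx0 := hq.1.le
    refine (summable_prod_of_nonneg fun p => ?_).2
      ⟨fun u => (hasSum_biTerm_fiber s r hq u).summable, ?_⟩
    · simp only [biTerm, Pi.zero_apply]
      positivity
    · simpa only [(hasSum_biTerm_fiber s r hq _).tsum_eq] using hsumF q hq
  refine ⟨fun q hq => (biIdxEquiv l).summable_iff.1 (hsum q hq), ?_⟩
  have hlim : Filter.Tendsto (fun q : ℝ => ∑' u, (1 - q) ^ (∑ j, s j) * F q u)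
      (nhdsWithin 1 (Set.Ioo (0 : ℝ) 1))
      (nhds (∑' u : U, (∏ j, ((r j)! : ℝ))⁻¹ * ∏ j, ((u.1 j : ℝ) ^ (s j - r j))⁻¹)) := by
    refine tendsto_tsum_of_dominated_convergence
      (hmzv.mul_left (∏ j, ((s j)! * Real.exp 1) / (r j)!)) (fun u => ?_) ?_
    · simp only [hscale]
      rw [← Finset.prod_inv_distrib, ← Finset.prod_mul_distrib]
      refine tendsto_finsetProd _ fun j _ => ?_
      have h := (tendsto_one_sub_pow_mul_powGeomSum (s j - 1) (u.2.2 j)).const_mul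
        ((u.1 j : ℝ) ^ r j / (r j)!)
      rw [hs] at h
      have e := pow_div_mul_inv_pow (u.2.2 j) (Nat.le_of_succ_le (hall j)) 1
      rw [one_mul, one_div] at e
      rwa [e] at h
    · filter_upwards [self_mem_nhdsWithin] with q hq u
      rw [Real.norm_of_nonneg (hnonneg q hq u)]
      exact hbound q hq u
  rw [tsum_mul_left] at hlim
  refine hlim.congr' ?_
  filter_upwards [self_mem_nhdsWithin] with q hq
  rw [tsum_mul_left, ← (biIdxEquiv l).tsum_eq, (hsum q hq).tsum_prod]
  simp only [(hasSum_biTerm_fiber s r hq _).tsum_eq, F]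
end
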